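/- There exists a rank-4 abstract polytope all of whose facets are isomorphic to the hemidodecahedron {5,3}₅ and all of whose vertex figures are isomorphic to the hemi-icosahedron {3,5}₅ (the 57-cell); any two such polytopes are isomorphic; and any such polytope has exactly 57 faces of rank 3 and its automorphism group has order 3420. -/

import Mathlib

universe u v

/-- An abstract polytope of rank `n`: a bounded poset equipped with a rank function
taking values in `{-1, 0, ..., n}`, such that every maximal chain (flag) contains exactly
one face of each rank, satisfying the diamond condition and strong flag-connectivity. -/
structure APolytope (n : ℕ) : Type (u + 1) where
  /-- the type of faces -/
  α : Type u
  [po : PartialOrder α]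
  [bo : BoundedOrder α]
  /-- the rank function -/
  rank : α → ℤ
  rank_bot : rank ⊥ = -1
  rank_top : rank ⊤ = (n : ℤ)
  rank_strictMono : StrictMono rank
  rank_mem : ∀ F : α, rank F ∈ Set.Icc (-1 : ℤ) (n : ℤ)
  /-- every flag (maximal chain) contains exactly one face of each rank `-1, ..., n`
  (hence exactly `n + 2` faces) -/
  flag_ranks : ∀ c : Set α, IsMaxChain (· ≤ ·) c →
    ∀ i ∈ Set.Icc (-1 : ℤ) (n : ℤ), ∃! F, F ∈ c ∧ rank F = i
  /-- the diamond condition -/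
  diamond : ∀ F G : α, F < G → rank G = rank F + 2 →
    ∃ H₁ H₂ : α, H₁ ≠ H₂ ∧ ∀ H : α, (F < H ∧ H < G) ↔ (H = H₁ ∨ H = H₂)
  /-- strong flag-connectivity: any two flags `c`, `d` are joined by a sequence of
  flags, successive ones differing in exactly one face, all containing `c ∩ d` -/
  connected : ∀ c d : Set α, IsMaxChain (· ≤ ·) c → IsMaxChain (· ≤ ·) d →
    Relation.ReflTransGen
      (fun x y : Set α => IsMaxChain (· ≤ ·) y ∧ c ∩ d ⊆ y ∧
        (∃ F G : α, x \ y = {F} ∧ y \ x = {G})) c d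

attribute [instance] APolytope.po APolytope.bo

namespace APolytope

variable {n : ℕ}

/-- A flag of a polytope is a maximal chain. -/
def IsFlag (P : APolytope.{u} n) (c : Set P.α) : Prop := IsMaxChain (· ≤ ·) c

/-- Two polytopes are isomorphic when there is an order isomorphism between their
face posets. -/
def Iso (P : APolytope.{u} n) (Q : APolytope.{v} n) : Prop := Nonempty (P.α ≃o Q.α)

/-- All facets (sections below a rank `n-1` face, including the least face) of `P`
are isomorphic to the poset `β`. In rank 4, facets are the sections `F/F₋₁` with
`rank F = 3`. -/
def FacetsAre (P : APolytope.{u} 4) (β : Type*) [PartialOrder β] : Prop :=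
  ∀ F : P.α, P.rank F = 3 → Nonempty (↥(Set.Iic F) ≃o β)

/-- All vertex figures (sections above a rank `0` face, up to the greatest face) of `P`
are isomorphic to the poset `β`. -/
def VertexFiguresAre (P : APolytope.{u} 4) (β : Type*) [PartialOrder β] : Prop :=
  ∀ x : P.α, P.rank x = 0 → Nonempty (↥(Set.Ici x) ≃o β)

end APolytope

def HemiIcosaPosetData : Finset (Finset (Fin 33)) :=
  {{0},
   {0, 1},
   {0, 2},
   {0, 3},
   {0, 4},
   {0, 5},
   {0, 6},
   {0, 1, 2, 7},
   {0, 1, 3, 8},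
   {0, 1, 5, 9},
   {0, 1, 4, 10},
   {0, 1, 6, 11},
   {0, 2, 3, 12},
   {0, 2, 6, 13},
   {0, 2, 4, 14},
   {0, 2, 5, 15},
   {0, 3, 4, 16},
   {0, 3, 5, 17},
   {0, 3, 6, 18},
   {0, 4, 5, 19},
   {0, 4, 6, 20},
   {0, 5, 6, 21},
   {0, 1, 2, 3, 7, 8, 12, 22},
   {0, 1, 2, 4, 7, 10, 14, 23},
   {0, 1, 3, 6, 8, 11, 18, 24},
   {0, 1, 4, 5, 9, 10, 19, 25},
   {0, 1, 5, 6, 9, 11, 21, 26},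
   {0, 2, 3, 5, 12, 15, 17, 27},
   {0, 2, 4, 6, 13, 14, 20, 28},
   {0, 2, 5, 6, 13, 15, 21, 29},
   {0, 3, 4, 5, 16, 17, 19, 30},
   {0, 3, 4, 6, 16, 18, 20, 31},
   {0, 1, 2, 3, 4, 5, 6, 7, 8, 9, 10, 11, 12, 13, 14, 15, 16, 17, 18, 19, 20, 21, 22, 23, 24, 25, 26, 27, 28, 29, 30, 31, 32}}

abbrev HemiIcosaPoset := {S : Finset (Fin 33) // S ∈ HemiIcosaPosetData}

/-- The hemidodecahedron is the order dual of the hemi-icosahedron. -/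
abbrev HemiDodecaPoset := HemiIcosaPosetᵒᵈ

namespace Cell57

/-! ### Coset enumeration -/

/-- The defining relators of the group of the 57-cell, in generators `0, 1, 2, 3`, closed under
cyclic permutation and reversal. -/
def relators : List (List (Fin 4)) :=
  [[0, 2], [2, 0], [0, 3], [3, 0], [1, 3], [3, 1]].map (fun w => w ++ w) ++
  [[1, 2], [2, 1]].map (fun w => w ++ w ++ w) ++
  [[0, 1], [1, 0], [2, 3], [3, 2], [0, 1, 2], [1, 2, 0], [2, 0, 1], [2, 1, 0], [1, 0, 2], [0, 2, 1],
    [1, 2, 3], [2, 3, 1], [3, 1, 2], [3, 2, 1], [2, 1, 3], [1, 3, 2]].map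
    (fun w => w ++ w ++ w ++ w ++ w)

/-- Apply the generators listed in a word, the first letter first. -/
def run {Y : Type*} (s : Fin 4 → Y → Y) (w : List (Fin 4)) (y : Y) : Y :=
  w.foldl (fun y i => s i y) y

@[simp] theorem run_nil {Y : Type*} (s : Fin 4 → Y → Y) (y : Y) : run s [] y = y := rfl

@[simp] theorem run_cons {Y : Type*} (s : Fin 4 → Y → Y) (i : Fin 4) (w : List (Fin 4)) (y : Y) :
    run s (i :: w) y = run s w (s i y) := rfl

theorem run_append {Y : Type*} (s : Fin 4 → Y → Y) (w w' : List (Fin 4)) (y : Y) :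
    run s (w ++ w') y = run s w' (run s w y) := List.foldl_append

/-- Involutions `s 0, ..., s 3` on `Y` satisfying the relators. -/
structure IsRelAction {Y : Type*} (s : Fin 4 → Y → Y) : Prop where
  invol : ∀ i, Function.Involutive (s i)
  rel : ∀ w ∈ relators, ∀ y, run s w y = y

theorem IsRelAction.run_injective {Y : Type*} {s : Fin 4 → Y → Y} (hs : IsRelAction s)
    (w : List (Fin 4)) : Function.Injective (run s w) := by
  induction w with
  | nil => exact fun _ _ h => h
  | cons i w ih => exact fun _ _ h => (hs.invol i).injective (ih h)

/-- The entry of a coset table. -/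
def look (t : List (List ℕ)) (i : ℕ) (s : Fin 4) : ℕ := (t.getD i []).getD s 0

/-- Trace a word through the edges of the table `t` marked in the bit mask `K`. -/
def trace (t : List (List ℕ)) (K : ℕ) : List (Fin 4) → ℕ → Option ℕ
  | [], i => some i
  | s :: w, i => if K.testBit (4 * i + s) then trace t K w (look t i s) else none

/-- Whether the edge `e` of the table `t` holds because `e.2` fixes the base point, or because it
defines its endpoint, or because it is the only unmarked edge of a relator cycle. -/
def justified (t : List (List ℕ)) (par : List (ℕ × Fin 4)) (fixd : List (Fin 4)) (K : ℕ)
    (e : ℕ × Fin 4) : Bool :=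
  (e.1 == 0 && fixd.contains e.2 && look t 0 e.2 == 0) ||
  (Nat.blt e.1 (look t e.1 e.2) && par.getD (look t e.1 e.2) (0, 0) == e) ||
  relators.any fun w => match w with
    | [] => false
    | s :: w => s == e.2 && trace t K w (look t e.1 e.2) == some e.1

/-- Check a list of successive deductions ending in a closed table with `N` rows. -/
def checkTable (t : List (List ℕ)) (N : ℕ) (par : List (ℕ × Fin 4)) (fixd gens : List (Fin 4)) :
    ℕ → List (ℕ × Fin 4) → Bool
  | K, [] => (List.range N).all fun i => gens.all fun s =>
      K.testBit (4 * i + s) && Nat.blt (look t i s) N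
  | K, e :: l => justified t par fixd K e && look t (look t e.1 e.2) e.2 == e.1 &&
      checkTable t N par fixd gens
        (K ||| 2 ^ (4 * e.1 + e.2) ||| 2 ^ (4 * look t e.1 e.2 + e.2)) l

/-- The points named by a coset table, along the spanning tree `par`. -/
noncomputable def point {Y : Type*} (s : Fin 4 → Y → Y) (par : List (ℕ × Fin 4)) (x₀ : Y)
    (k : ℕ) : Y :=
  if _h : (par.getD k (0, 0)).1 < k then
    s (par.getD k (0, 0)).2 (point s par x₀ (par.getD k (0, 0)).1) else x₀
termination_by k

theorem trace_sound {Y : Type*} {s : Fin 4 → Y → Y} {x : ℕ → Y} {t : List (List ℕ)} {K : ℕ}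
    (hK : ∀ i (k : Fin 4), K.testBit (4 * i + k) → s k (x i) = x (look t i k))
    (w : List (Fin 4)) (i j : ℕ) (h : trace t K w i = some j) : run s w (x i) = x j := by
  induction w generalizing i with
  | nil => simp only [trace, Option.some.injEq] at h; simp [h]
  | cons k w ih =>
    simp only [trace] at h
    split_ifs at h with hk
    rw [run_cons, hK i k hk]
    exact ih _ h

theorem justified_sound {Y : Type*} {s : Fin 4 → Y → Y} (hs : IsRelAction s) {t : List (List ℕ)}
    {par : List (ℕ × Fin 4)} {fixd : List (Fin 4)} {x₀ : Y} (hx₀ : ∀ k ∈ fixd, s k x₀ = x₀)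
    {K : ℕ} (hK : ∀ i (k : Fin 4), K.testBit (4 * i + k) →
      s k (point s par x₀ i) = point s par x₀ (look t i k))
    (e : ℕ × Fin 4) (he : justified t par fixd K e) :
    s e.2 (point s par x₀ e.1) = point s par x₀ (look t e.1 e.2) := by
  have h0 : point s par x₀ 0 = x₀ := by rw [point]; simp
  simp only [justified, Bool.or_eq_true, Bool.and_eq_true, beq_iff_eq, List.contains_iff_mem,
    List.any_eq_true] at he
  rcases he with (⟨⟨h1, h2⟩, h3⟩ | ⟨h1, h2⟩) | ⟨w, hw, h⟩
  · rw [h1, h3, h0, hx₀ _ h2]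
  · rw [point.eq_1 s par x₀ (look t e.1 e.2), h2, dif_pos (by simpa using h1)]
  · cases w with
    | nil => simp at h
    | cons k w =>
      simp only [Bool.and_eq_true, beq_iff_eq] at h
      obtain ⟨rfl, h⟩ := h
      apply hs.run_injective w
      rw [trace_sound hK w _ _ h]
      exact hs.rel _ hw _

theorem testBit_mark {K i j : ℕ} {k l : Fin 4}
    (h : (K ||| 2 ^ (4 * j + l.val)).testBit (4 * i + k)) :
    K.testBit (4 * i + k) ∨ (i = j ∧ k = l) := by
  rw [Nat.testBit_or, Bool.or_eq_true, Nat.testBit_two_pow, decide_eq_true_eq] at h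
  refine h.imp_right fun h => ?_
  have := k.2; have := l.2
  exact ⟨by omega, Fin.ext (by omega)⟩

theorem checkTable_sound {Y : Type*} {s : Fin 4 → Y → Y} (hs : IsRelAction s)
    {t : List (List ℕ)} {N : ℕ} {par : List (ℕ × Fin 4)} {fixd gens : List (Fin 4)} {x₀ : Y}
    (hx₀ : ∀ k ∈ fixd, s k x₀ = x₀) (l : List (ℕ × Fin 4)) (K : ℕ)
    (hK : ∀ i (k : Fin 4), K.testBit (4 * i + k) →
      s k (point s par x₀ i) = point s par x₀ (look t i k))
    (hl : checkTable t N par fixd gens K l) :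
    ∀ i < N, ∀ k ∈ gens, look t i k < N ∧
      s k (point s par x₀ i) = point s par x₀ (look t i k) := by
  induction l generalizing K with
  | nil =>
    intro i hi k hk
    simp only [checkTable, List.all_eq_true, List.mem_range, Bool.and_eq_true] at hl
    exact ⟨by simpa using (hl i hi k hk).2, hK i k (hl i hi k hk).1⟩
  | cons e l ih =>
    simp only [checkTable, Bool.and_eq_true, beq_iff_eq] at hl
    obtain ⟨⟨h1, h2⟩, h3⟩ := hl
    have he := justified_sound hs hx₀ hK e h1
    refine ih _ (fun i k hik => ?_) h3
    rcases testBit_mark hik with hik | ⟨rfl, rfl⟩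
    · rcases testBit_mark hik with hik | ⟨rfl, rfl⟩
      · exact hK i k hik
      · exact he
    · rw [h2, ← he, hs.invol]

/-- A successful check bounds the set of points reachable from the base point. -/
theorem exists_closed_points {Y : Type*} {s : Fin 4 → Y → Y} (hs : IsRelAction s)
    {t : List (List ℕ)} {N : ℕ} {par : List (ℕ × Fin 4)} {fixd gens : List (Fin 4)}
    {l : List (ℕ × Fin 4)} (hl : checkTable t N par fixd gens 0 l) {x₀ : Y}
    (hx₀ : ∀ k ∈ fixd, s k x₀ = x₀) :
    ∃ x : ℕ → Y, x 0 = x₀ ∧ ∀ i < N, ∀ k ∈ gens, ∃ j < N, s k (x i) = x j :=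
  ⟨point s par x₀, by rw [point]; simp, fun i hi k hk =>
    ⟨_, checkTable_sound hs hx₀ l 0 (by simp) hl i hi k hk⟩⟩

/-- The coset table of the subgroup generated by `1, 2, 3`. -/
def vertexTable : List (List ℕ) :=
  [[1, 0, 0, 0], [0, 2, 1, 1], [3, 1, 4, 2], [2, 5, 6, 3], [6, 4, 2, 7], [5, 3, 8, 5], [4,
  9, 3, 10], [10, 7, 11, 4], [8, 12, 5, 13], [12, 6, 12, 14], [7, 14, 15, 6], [15, 16, 7,
  16], [9, 8, 9, 17], [13, 17, 18, 8], [17, 10, 19, 9], [11, 20, 10, 21], [21, 11, 16, 11],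
  [14, 13, 22, 12], [18, 23, 13, 24], [22, 25, 14, 26], [27, 15, 25, 28], [16, 28, 21, 15],
  [19, 29, 17, 30], [31, 18, 29, 32], [24, 32, 24, 18], [33, 19, 20, 34], [30, 34, 35, 19],
  [20, 36, 33, 37], [37, 21, 38, 20], [39, 22, 23, 40], [26, 40, 41, 22], [23, 42, 39, 43],
  [43, 24, 44, 23], [25, 45, 27, 46], [46, 26, 40, 25], [41, 41, 26, 41], [47, 27, 48, 47],
  [28, 47, 42, 27], [42, 38, 28, 44], [29, 49, 31, 50], [50, 30, 34, 29], [35, 35, 30, 35],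
  [38, 31, 37, 51], [32, 51, 51, 31], [51, 44, 32, 38], [52, 33, 52, 53], [34, 53, 50, 33],
  [36, 37, 49, 36], [49, 52, 36, 54], [48, 39, 47, 55], [40, 55, 46, 39], [44, 43, 43, 42],
  [45, 48, 45, 56], [56, 46, 54, 45], [55, 56, 53, 48], [54, 50, 56, 49], [53, 54, 55, 52]]

/-- The spanning tree of `vertexTable`, after a dummy entry for the root. -/
def vertexTree : List (ℕ × Fin 4) := (0, 0) ::
  [(0, 0), (1, 1), (2, 0), (2, 2), (3, 1), (3, 2), (4, 3), (5, 2), (6, 1), (6, 3), (7, 2), (8, 1),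
  (8, 3), (9, 3), (10, 2), (11, 1), (12, 3), (13, 2), (14, 2), (15, 1), (15, 3), (17, 2), (18, 1),
  (18, 3), (19, 1), (19, 3), (20, 0), (20, 3), (22, 1), (22, 3), (23, 0), (23, 3), (25, 0), (25, 3),
  (26, 2), (27, 1), (27, 3), (28, 2), (29, 0), (29, 3), (30, 2), (31, 1), (31, 3), (32, 2), (33, 1),
  (33, 3), (36, 0), (36, 2), (39, 1), (39, 3), (42, 3), (45, 0), (45, 3), (48, 3), (49, 3), (52, 3)]

/-- The remaining edges of `vertexTable`, in order of deduction. -/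
def vertexDeductions : List (ℕ × Fin 4) :=
  [(1, 2), (1, 3), (2, 3), (3, 3), (4, 1), (5, 0), (5, 3), (4, 0), (7, 1), (8, 0), (7, 0), (9, 2),
  (12, 0), (13, 0), (10, 1), (11, 0), (11, 3), (16, 2), (13, 1), (14, 0), (18, 0), (16, 0), (21, 2),
  (19, 0), (24, 0), (24, 2), (20, 2), (21, 1), (23, 2), (26, 0), (24, 1), (27, 2), (26, 1), (28, 0),
  (38, 1), (31, 2), (30, 1), (34, 2), (35, 0), (35, 1), (35, 3), (37, 2), (38, 0), (32, 0), (38, 3),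
  (44, 1), (34, 0), (37, 1), (47, 3), (47, 2), (48, 0), (40, 0), (46, 2), (43, 1), (43, 2), (44, 0),
  (45, 2), (48, 1), (46, 1), (53, 2), (50, 1), (54, 0), (53, 0), (54, 1), (55, 2)]

/-- The regular representation of the group of the hemi-icosahedron, on generators `1, 2, 3`. -/
def flagTable : List (List ℕ) :=
  [[0, 1, 2, 3], [0, 0, 4, 5], [0, 6, 0, 7], [0, 5, 8, 0], [0, 9, 1, 10], [0, 3, 11, 1], [0,
  2, 9, 12], [0, 12, 13, 2], [0, 14, 3, 15], [0, 4, 6, 16], [0, 16, 17, 4], [0, 18, 5, 19],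
  [0, 7, 20, 6], [0, 21, 7, 22], [0, 8, 18, 23], [0, 23, 24, 8], [0, 10, 25, 9], [0, 26, 10,
  27], [0, 11, 14, 28], [0, 28, 29, 11], [0, 30, 12, 31], [0, 13, 30, 32], [0, 32, 33, 13],
  [0, 15, 34, 14], [0, 35, 15, 33], [0, 36, 16, 37], [0, 17, 36, 38], [0, 38, 39, 17], [0,
  19, 40, 18], [0, 41, 19, 39], [0, 20, 21, 42], [0, 42, 43, 20], [0, 22, 44, 21], [0, 45,
  22, 24], [0, 46, 23, 47], [0, 24, 46, 45], [0, 25, 26, 48], [0, 48, 49, 25], [0, 27, 50,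
  26], [0, 51, 27, 29], [0, 52, 28, 53], [0, 29, 52, 51], [0, 31, 54, 30], [0, 55, 31, 49],
  [0, 56, 32, 57], [0, 33, 56, 35], [0, 34, 35, 58], [0, 58, 59, 34], [0, 37, 58, 36], [0,
  59, 37, 43], [0, 57, 38, 56], [0, 39, 57, 41], [0, 40, 41, 54], [0, 54, 55, 40], [0, 53,
  42, 52], [0, 43, 53, 59], [0, 44, 45, 50], [0, 50, 51, 44], [0, 47, 48, 46], [0, 49, 47,
  55]]

/-- The spanning tree of `flagTable`, after a dummy entry for the root. -/
def flagTree : List (ℕ × Fin 4) := (0, 0) ::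
  [(0, 1), (0, 2), (0, 3), (1, 2), (1, 3), (2, 1), (2, 3), (3, 2), (4, 1), (4, 3), (5, 2), (6, 3),
  (7, 2), (8, 1), (8, 3), (9, 3), (10, 2), (11, 1), (11, 3), (12, 2), (13, 1), (13, 3), (14, 3),
  (15, 2), (16, 2), (17, 1), (17, 3), (18, 3), (19, 2), (20, 1), (20, 3), (21, 3), (22, 2), (23, 2),
  (24, 1), (25, 1), (25, 3), (26, 3), (27, 2), (28, 2), (29, 1), (30, 3), (31, 2), (32, 2), (33, 1),
  (34, 1), (34, 3), (36, 3), (37, 2), (38, 2), (39, 1), (40, 1), (40, 3), (42, 2), (43, 1), (44, 1),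
  (44, 3), (46, 3), (47, 2)]

/-- The remaining edges of `flagTable`, in order of deduction. -/
def flagDeductions : List (ℕ × Fin 4) :=
  [(3, 1), (6, 2), (7, 1), (10, 1), (14, 2), (15, 1), (19, 1), (21, 2), (22, 1), (24, 3), (26, 2),
  (27, 1), (29, 3), (31, 1), (35, 3), (35, 2), (37, 1), (43, 3), (41, 3), (41, 2), (52, 3), (53, 1),
  (53, 2), (45, 2), (50, 3), (50, 1), (51, 2), (47, 1), (48, 2), (49, 1), (55, 3)]

theorem checkTable_vertex : checkTable vertexTable 57 vertexTree [1, 2, 3] [0, 1, 2, 3] 0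
    ([(0, 1), (0, 2), (0, 3)] ++ vertexTree.tail ++ vertexDeductions) := by decide +kernel

theorem checkTable_flag : checkTable flagTable 60 flagTree [] [1, 2, 3] 0
    (flagTree.tail ++ flagDeductions) := by decide +kernel

/-! ### The group of the 57-cell -/

/-- The group presented by four involutions and the relators. -/
abbrev Grp : Type := PresentedGroup
  {x : FreeGroup (Fin 4) | (∃ i, x = FreeGroup.of i * FreeGroup.of i) ∨
    ∃ w ∈ relators, x = (w.map FreeGroup.of).reverse.prod}

/-- The generators of the group of the 57-cell. -/
def gen (i : Fin 4) : Grp := PresentedGroup.of i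

theorem run_eq_smul {M Y : Type*} [Monoid M] [MulAction M Y] (g : Fin 4 → M) (w : List (Fin 4))
    (y : Y) : run (fun i y => g i • y) w y = (w.map g).reverse.prod • y := by
  induction w generalizing y with
  | nil => simp
  | cons i w ih => simp [ih, mul_smul]

theorem gen_mul_self (i : Fin 4) : gen i * gen i = 1 :=
  PresentedGroup.one_of_mem (rels := {x : FreeGroup (Fin 4) |
    (∃ i, x = FreeGroup.of i * FreeGroup.of i) ∨
    ∃ w ∈ relators, x = (w.map FreeGroup.of).reverse.prod})
    (x := FreeGroup.of i * FreeGroup.of i) (Or.inl ⟨i, rfl⟩)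

theorem relator_eq_one {w : List (Fin 4)} (hw : w ∈ relators) : (w.map gen).reverse.prod = 1 := by
  have h := PresentedGroup.one_of_mem (rels := {x : FreeGroup (Fin 4) |
    (∃ i, x = FreeGroup.of i * FreeGroup.of i) ∨
    ∃ w ∈ relators, x = (w.map FreeGroup.of).reverse.prod}) (Or.inr ⟨w, hw, rfl⟩)
  rw [map_list_prod, List.map_reverse, List.map_map] at h
  exact h

theorem isRelAction_smul {Y : Type*} [MulAction Grp Y] :
    IsRelAction fun (i : Fin 4) (y : Y) => gen i • y where
  invol i y := by simp only [smul_smul, gen_mul_self, one_smul]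
  rel w hw y := by rw [run_eq_smul, relator_eq_one hw, one_smul]

theorem closure_gen : Subgroup.closure (Set.range gen) = ⊤ :=
  PresentedGroup.closure_range_of _

theorem gen_inv (i : Fin 4) : (gen i)⁻¹ = gen i := inv_eq_of_mul_eq_one_left (gen_mul_self i)

/-- A set stable under generators is stable under the subgroup they generate. -/
theorem smul_mem_of_closure {Y : Type*} [MulAction Grp Y] {S : Set Y} {I : Set (Fin 4)}
    (hS : ∀ i ∈ I, ∀ y ∈ S, gen i • y ∈ S) {g : Grp} (hg : g ∈ Subgroup.closure (gen '' I)) :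
    ∀ y ∈ S, g • y ∈ S := by
  induction hg using Subgroup.closure_induction'' with
  | mem x hx => obtain ⟨i, hi, rfl⟩ := hx; exact hS i hi
  | inv_mem x hx => obtain ⟨i, hi, rfl⟩ := hx; rw [gen_inv]; exact hS i hi
  | one => simp
  | mul x y _ _ hx hy => intro z hz; rw [mul_smul]; exact hx _ (hy _ hz)

theorem card_le_of_points {Y : Type*} {N : ℕ} {x : ℕ → Y} (h : ∀ y, ∃ i < N, y = x i) :
    Finite Y ∧ Nat.card Y ≤ N := by
  have hs : Function.Surjective fun i : Fin N => x i := fun y => by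
    obtain ⟨i, hi, rfl⟩ := h y; exact ⟨⟨i, hi⟩, rfl⟩
  exact ⟨Finite.of_surjective _ hs, by simpa using Nat.card_le_card_of_surjective _ hs⟩

theorem card_grp_le : Finite Grp ∧ Nat.card Grp ≤ 57 * 60 := by
  set K : Subgroup Grp := Subgroup.closure (gen '' {1, 2, 3}) with hKdef
  have hgen : ∀ k : Fin 4, k ∈ [1, 2, 3] → gen k ∈ K := fun k hk =>
    Subgroup.subset_closure ⟨k, by simpa using hk, rfl⟩
  obtain ⟨x, hx0, hx⟩ := exists_closed_points (isRelAction_smul (Y := Grp ⧸ K)) checkTable_vertex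
    (x₀ := ((1 : Grp) : Grp ⧸ K)) (fun k hk => by
      change ((gen k * 1 : Grp) : Grp ⧸ K) = ((1 : Grp) : Grp ⧸ K)
      rw [QuotientGroup.eq]
      simpa using hgen k hk)
  have h57 := card_le_of_points (N := 57) (x := x) fun y => by
    obtain ⟨g, rfl⟩ := QuotientGroup.mk_surjective y
    have := smul_mem_of_closure (S := {y | ∃ i < 57, y = x i}) (I := Set.univ) (g := g)
      (by
        rintro i - _ ⟨j, hj, rfl⟩
        exact hx j hj i (by fin_cases i <;> simp))
      (by rw [Set.image_univ, closure_gen]; trivial) (x 0) ⟨0, by simp, rfl⟩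
    rw [hx0] at this
    obtain ⟨i, hi, h⟩ := this
    exact ⟨i, hi, (congrArg ((↑) : Grp → Grp ⧸ K) (mul_one g)).symm.trans h⟩
  obtain ⟨z, hz0, hz⟩ := exists_closed_points (isRelAction_smul (Y := Grp)) checkTable_flag
    (x₀ := (1 : Grp)) (by simp)
  have h60 := card_le_of_points (Y := K) (N := 60)
    (x := fun i => open Classical in if h : z i ∈ K then ⟨z i, h⟩ else 1) fun y => by
    obtain ⟨i, hi, h⟩ := smul_mem_of_closure (S := {y | ∃ i < 60, y = z i}) (I := {1, 2, 3})
      (by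
        rintro i hi' _ ⟨j, hj, rfl⟩
        exact hz j hj i (by simpa using hi'))
      y.2 (z 0) ⟨0, by simp, rfl⟩
    rw [hz0, smul_eq_mul, mul_one] at h
    exact ⟨i, hi, by simp [← h]⟩
  have := h57.1; have := h60.1
  have e := Subgroup.groupEquivQuotientProdSubgroup (s := K)
  refine ⟨Finite.of_equiv _ e.symm, ?_⟩
  rw [Nat.card_congr e, Nat.card_prod]
  exact Nat.mul_le_mul h57.2 h60.2

end Cell57

namespace Cell57

/-! ### The hemi-icosahedron, with faces labelled by `Fin 33` -/

/-- The vertex sets of the faces of the hemi-icosahedron, as bit masks. -/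
def faceCode (a : Fin 33) : ℕ :=
  List.getD
    [0, 1, 2, 4, 8, 16, 32, 3, 5, 17, 9, 33, 6, 34, 10, 18, 12, 20, 36, 24, 40, 48, 7, 11, 37,
    25, 49, 22, 42, 50, 28, 44, 63] a 0

/-- Incidence of faces of the hemi-icosahedron. -/
def hle (a b : Fin 33) : Bool := faceCode a &&& faceCode b == faceCode a

/-- The flags of the hemi-icosahedron, numbered as in `flagTable`. -/
def flagList : List (List ℕ) :=
  [[1, 7, 22], [2, 7, 22], [1, 8, 22], [1, 7, 23], [2, 12, 22], [2, 7, 23], [3, 8, 22], [1,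
  8, 24], [1, 10, 23], [3, 12, 22], [2, 12, 27], [2, 14, 23], [3, 8, 24], [1, 11, 24], [4,
  10, 23], [1, 10, 25], [3, 12, 27], [2, 15, 27], [4, 14, 23], [2, 14, 28], [3, 18, 24], [6,
  11, 24], [1, 11, 26], [4, 10, 25], [1, 9, 25], [3, 17, 27], [5, 15, 27], [2, 15, 29], [4,
  14, 28], [2, 13, 28], [6, 18, 24], [3, 18, 31], [6, 11, 26], [1, 9, 26], [4, 19, 25], [5,
  9, 25], [5, 17, 27], [3, 17, 30], [5, 15, 29], [2, 13, 29], [4, 20, 28], [6, 13, 28], [6,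
  18, 31], [3, 16, 31], [6, 21, 26], [5, 9, 26], [5, 19, 25], [4, 19, 30], [5, 17, 30], [3,
  16, 30], [5, 21, 29], [6, 13, 29], [6, 20, 28], [4, 20, 31], [6, 20, 31], [4, 16, 31], [5,
  21, 26], [6, 21, 29], [5, 19, 30], [4, 16, 30]]

/-- The face of rank `i - 1` in the `k`-th flag of the hemi-icosahedron. -/
def flag (k : Fin 60) (i : Fin 4) : Fin 33 :=
  Fin.ofNat 33 ((0 :: flagList.getD k []).getD i 0)

/-- The flag adjacent to the `k`-th flag in the face of rank `i - 1`. -/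
def rho (i : Fin 4) (k : Fin 60) : Fin 60 := Fin.ofNat 60 (look flagTable k i)

theorem hle_trans : ∀ a b, hle a b → ∀ c, hle b c → hle a c := by decide +kernel

theorem hle_refl : ∀ a, hle a a := by decide +kernel

theorem hle_antisymm : ∀ a b, hle a b → hle b a → a = b := by decide +kernel

theorem hle_top : ∀ a, hle a 32 := by decide +kernel

theorem bot_hle : ∀ a, hle 0 a := by decide +kernel

theorem flag_zero : ∀ k, flag k 0 = 0 := by decide +kernel

theorem flag_ne_top : ∀ k i, flag k i ≠ 32 := by decide +kernel

theorem flag_strictMono : ∀ k (i j : Fin 4), i < j → hle (flag k i) (flag k j) ∧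
    flag k i ≠ flag k j := by decide +kernel

theorem flag_injective : ∀ k l, (∀ i, flag k i = flag l i) → k = l := by decide +kernel

theorem exists_flag_eq : ∀ b, b ≠ 0 → ∀ c, hle b c ∧ b ≠ c → ∀ d, hle c d ∧ c ≠ d → d ≠ 32 →
    ∃ k, flag k 1 = b ∧ flag k 2 = c ∧ flag k 3 = d := by decide +kernel

theorem exists_flag_of_hle : ∀ a b, hle a b → b ≠ 32 → ∃ k i j, flag k i = a ∧ flag k j = b := by
  decide +kernel

theorem eq_or_eq_of_flag_hle : ∀ k b, hle (flag k 3) b → b = flag k 3 ∨ b = 32 := by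
  decide +kernel

theorem flag_rho : ∀ i, i ≠ 0 → ∀ k j, flag k j = flag (rho i k) j ↔ j ≠ i := by decide +kernel

theorem eq_rho : ∀ k l, ∀ i, (∀ j, flag k j = flag l j ↔ j ≠ i) → l = rho i k := by decide +kernel

theorem run_rho_relators : ∀ w ∈ relators, 0 ∉ w → ∀ k, run rho w k = k := by decide +kernel

/-- A word leading from flag `0` to flag `k`. -/
def treeWord : ℕ → ℕ → List (Fin 4)
  | 0, _ => []
  | n + 1, k => if k = 0 then [] else
      treeWord n (flagTree.getD k (0, 0)).1 ++ [(flagTree.getD k (0, 0)).2]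

theorem run_treeWord : ∀ k : Fin 60, 0 ∉ treeWord 60 k ∧ run rho (treeWord 60 k) 0 = k ∧
    run rho (treeWord 60 k).reverse k = 0 := by decide +kernel

/-- Words in two of the generators `1, 2, 3`, representing all elements of the dihedral groups. -/
def dihedralWords : List (List (Fin 4)) :=
  [[1, 2, 1, 2, 1], [2, 1, 2, 1, 2], [2, 3, 2, 3, 2], [3, 2, 3, 2, 3], [1, 3, 1], [3, 1, 3]].flatMap
    List.inits

theorem exists_dihedralWord : ∀ k l, (∃ i, i ≠ 0 ∧ flag k i = flag l i) →
    ∃ w ∈ dihedralWords, (∀ i ∈ w, flag k i ≠ flag l i) ∧ run rho w k = l := by decide +kernel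

theorem exists_word (k l : Fin 60) :
    ∃ w, 0 ∉ w ∧ (∀ i ∈ w, flag k i ≠ flag l i) ∧ run rho w k = l := by
  by_cases h : ∃ i, i ≠ 0 ∧ flag k i = flag l i
  · obtain ⟨w, -, hw, hr⟩ := exists_dihedralWord k l h
    exact ⟨w, fun h0 => hw 0 h0 (by rw [flag_zero, flag_zero]), hw, hr⟩
  · push Not at h
    obtain ⟨hk, -, hk'⟩ := run_treeWord k
    obtain ⟨hl, hl', -⟩ := run_treeWord l
    have h0 : 0 ∉ (treeWord 60 k).reverse ++ treeWord 60 l := by simp [hk, hl]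
    exact ⟨_, h0, fun i hi => h i fun hi0 => h0 (hi0 ▸ hi), by rw [run_append, hk', hl']⟩

theorem exists_four_flags : flag 0 3 = 22 ∧ (∃ k, flag k 3 = 23) ∧ (∃ k, flag k 3 = 24) ∧
    ∃ k, flag k 3 = 25 := by decide +kernel

end Cell57

namespace Cell57

open OrderDual

/-! ### Posets that are locally like the 57-cell -/

section Poset

variable {α : Type*} [PartialOrder α]

/-- `e` labels the faces above `x` by the faces of the hemi-icosahedron. -/
structure Labelling (x : α) (e : Fin 33 → α) : Prop where
  le_iff : ∀ a b, e a ≤ e b ↔ hle a b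
  range : ∀ y, x ≤ y ↔ ∃ a, e a = y

namespace Labelling

theorem injective {x : α} {e : Fin 33 → α} (L : Labelling x e)
    : Function.Injective e := fun a b h =>
  hle_antisymm a b ((L.le_iff a b).1 h.le) ((L.le_iff b a).1 h.ge)

theorem lt_iff {x : α} {e : Fin 33 → α} (L : Labelling x e)
    {a b : Fin 33} : e a < e b ↔ hle a b ∧ a ≠ b := by
  rw [lt_iff_le_and_ne, L.le_iff, L.injective.ne_iff]

theorem apply_zero {x : α} {e : Fin 33 → α} (L : Labelling x e)
    : e 0 = x := by
  obtain ⟨a, ha⟩ := (L.range x).1 le_rfl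
  exact le_antisymm (ha ▸ (L.le_iff 0 a).2 (bot_hle a)) ((L.range _).2 ⟨0, rfl⟩)

end Labelling

variable [BoundedOrder α]

/-- The proper faces of a flag of a poset of rank 4. -/
@[ext]
structure Flag (α : Type*) [PartialOrder α] [BoundedOrder α] where
  /-- The faces, by increasing rank. -/
  face : Fin 4 → α
  strictMono : StrictMono face
  bot_lt : ⊥ < face 0
  lt_top : face 3 < ⊤

/-- Two flags differ exactly in the face of rank `i`. -/
def Flag.Adj (i : Fin 4) (f g : Flag α) : Prop := ∀ j, f.face j = g.face j ↔ j ≠ i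

theorem Flag.Adj.symm {i : Fin 4} {f g : Flag α} (h : f.Adj i g) : g.Adj i f := fun j =>
  eq_comm.trans (h j)

/-- The flag with given faces. -/
def Flag.of (a b c d : α) (h : ⊥ < a ∧ a < b ∧ b < c ∧ c < d ∧ d < ⊤) : Flag α where
  face := ![a, b, c, d]
  strictMono := Fin.strictMono_iff_lt_succ.2 fun i => by
    fin_cases i
    exacts [h.2.1, h.2.2.1, h.2.2.2.1]
  bot_lt := h.1
  lt_top := h.2.2.2.2

theorem Flag.lt_succ (f : Flag α) :
    ⊥ < f.face 0 ∧ f.face 0 < f.face 1 ∧ f.face 1 < f.face 2 ∧ f.face 2 < f.face 3 ∧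
      f.face 3 < ⊤ :=
  ⟨f.bot_lt, f.strictMono (by decide), f.strictMono (by decide), f.strictMono (by decide),
    f.lt_top⟩

theorem Flag.bot_lt_face (f : Flag α) (i : Fin 4) : ⊥ < f.face i :=
  f.bot_lt.trans_le (f.strictMono.monotone (Fin.zero_le i))

theorem Flag.face_lt_top (f : Flag α) (i : Fin 4) : f.face i < ⊤ :=
  (f.strictMono.monotone (Fin.le_last i)).trans_lt f.lt_top

/-- The same flag in the dual poset. -/
def Flag.dual : Flag α ≃ Flag αᵒᵈ where
  toFun f := ⟨fun i => toDual (f.face i.rev), fun _ _ h => f.strictMono (Fin.rev_lt_rev.2 h),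
    f.lt_top, f.bot_lt⟩
  invFun f := ⟨fun i => ofDual (f.face i.rev), fun _ _ h => f.strictMono (Fin.rev_lt_rev.2 h),
    f.lt_top, f.bot_lt⟩
  left_inv f := by ext i; simp
  right_inv f := by ext i; simp

theorem Flag.dual_face (f : Flag α) (i : Fin 4) : f.dual.face i = toDual (f.face i.rev) := rfl

theorem Flag.dual_adj {i : Fin 4} {f g : Flag α} : f.dual.Adj i.rev g.dual ↔ f.Adj i g := by
  refine ⟨fun h j => ?_, fun h j => ?_⟩
  · simpa [Flag.dual_face] using h j.rev
  · simpa [Flag.dual_face, Fin.rev_eq_iff] using h j.rev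

namespace Labelling

theorem apply_top {x : α} {e : Fin 33 → α} (L : Labelling x e)
    : e 32 = ⊤ := by
  obtain ⟨a, ha⟩ := (L.range ⊤).1 le_top
  exact le_antisymm le_top (ha ▸ (L.le_iff a 32).2 (hle_top a))

/-- The flags containing the vertex `x`. -/
def mkFlag {x : α} {e : Fin 33 → α} (L : Labelling x e)
    (hx : IsAtom x) (k : Fin 60) : Flag α where
  face i := e (flag k i)
  strictMono _ _ h := L.lt_iff.2 (flag_strictMono k _ _ h)
  bot_lt := by rw [flag_zero, L.apply_zero]; exact hx.bot_lt
  lt_top := by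
    rw [← L.apply_top]
    exact L.lt_iff.2 ⟨hle_top _, flag_ne_top k 3⟩

theorem mkFlag_face {x : α} {e : Fin 33 → α} (L : Labelling x e) (hx : IsAtom x)
    (k : Fin 60) (i : Fin 4) : (L.mkFlag hx k).face i = e (flag k i) := rfl

theorem mkFlag_face_zero {x : α} {e : Fin 33 → α} (L : Labelling x e) (hx : IsAtom x)
    (k : Fin 60) : (L.mkFlag hx k).face 0 = x := by
  rw [mkFlag_face, flag_zero, L.apply_zero]

theorem mkFlag_injective {x : α} {e : Fin 33 → α} (L : Labelling x e) (hx : IsAtom x)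
    : Function.Injective (L.mkFlag hx) := fun k l h =>
  flag_injective k l fun i => L.injective (congrArg (fun f => f.face i) h)

theorem exists_mkFlag {x : α} {e : Fin 33 → α} (L : Labelling x e) (hx : IsAtom x)
    {f : Flag α} (hf : f.face 0 = x) : ∃ k, L.mkFlag hx k = f := by
  have hr (i : Fin 4) : ∃ a, e a = f.face i :=
    (L.range _).1 (hf ▸ f.strictMono.monotone (Fin.zero_le i))
  choose a ha using hr
  have hlt {i j : Fin 4} (h : i < j) : hle (a i) (a j) ∧ a i ≠ a j :=
    L.lt_iff.1 (by rw [ha, ha]; exact f.strictMono h)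
  have h0 : a 0 = 0 := L.injective (by rw [ha, L.apply_zero, hf])
  obtain ⟨k, h1, h2, h3⟩ := exists_flag_eq (a 1) (fun h => (hlt (i := 0) (j := 1) (by decide)).2
    (h0.trans h.symm)) (a 2) (hlt (by decide)) (a 3) (hlt (by decide)) fun h => by
      have := f.lt_top
      rw [← ha, h, L.apply_top] at this
      exact this.false
  refine ⟨k, Flag.ext (funext fun i => ?_)⟩
  rw [mkFlag_face, ← ha]
  congr 1
  fin_cases i
  exacts [(flag_zero k).trans h0.symm, h1, h2, h3]

theorem adj_mkFlag {x : α} {e : Fin 33 → α} (L : Labelling x e) (hx : IsAtom x)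
    {i : Fin 4} {k l : Fin 60} :
    (L.mkFlag hx k).Adj i (L.mkFlag hx l) ↔ ∀ j, flag k j = flag l j ↔ j ≠ i := by
  simp only [Flag.Adj, mkFlag_face, L.injective.eq_iff]

end Labelling

/-- A poset of rank 4 whose vertex figures are hemi-icosahedra and whose facets are
hemidodecahedra, with connected flag graph. -/
structure IsCell57 (α : Type*) [PartialOrder α] [BoundedOrder α] : Prop where
  bot_ne_top : (⊥ : α) ≠ ⊤
  atomic : ∀ y : α, y ≠ ⊥ → ∃ x, IsAtom x ∧ x ≤ y
  coatomic : ∀ y : α, y ≠ ⊤ → ∃ x, IsCoatom x ∧ y ≤ x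
  up : ∀ x : α, IsAtom x → ∃ e, Labelling x e
  down : ∀ x : α, IsCoatom x → ∃ e, Labelling (toDual x) e
  conn : ∀ f g : Flag α, Relation.ReflTransGen (fun f g => ∃ i, Flag.Adj i f g) f g

namespace IsCell57

theorem dual (C : IsCell57 α) : IsCell57 αᵒᵈ where
  bot_ne_top := C.bot_ne_top.symm
  atomic y hy := by
    obtain ⟨x, hx, h⟩ := C.coatomic (ofDual y) hy
    exact ⟨toDual x, hx.dual, h⟩
  coatomic y hy := by
    obtain ⟨x, hx, h⟩ := C.atomic (ofDual y) hy
    exact ⟨toDual x, hx.dual, h⟩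
  up x hx := C.down (ofDual x) hx
  down x hx := by
    obtain ⟨e, L⟩ := C.up (ofDual x) hx
    exact ⟨fun a => toDual (toDual (e a)), L.le_iff, L.range⟩
  conn f g := by
    obtain ⟨f, rfl⟩ := Flag.dual.surjective f
    obtain ⟨g, rfl⟩ := Flag.dual.surjective g
    exact (C.conn f g).lift Flag.dual fun _ _ ⟨i, h⟩ => ⟨i.rev, Flag.dual_adj.2 h⟩

theorem isAtom_face_zero (C : IsCell57 α) (f : Flag α) : IsAtom (f.face 0) := by
  obtain ⟨x, hx, hxf⟩ := C.atomic _ f.bot_lt.ne'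
  obtain rfl | hlt := hxf.eq_or_lt
  · exact hx
  exfalso
  obtain ⟨e, L⟩ := C.up x hx
  have hr (i : Fin 4) : ∃ a, e a = f.face i :=
    (L.range _).1 (hxf.trans (f.strictMono.monotone (Fin.zero_le i)))
  choose a ha using hr
  have hlt' {i j : Fin 4} (h : i < j) : hle (a i) (a j) ∧ a i ≠ a j :=
    L.lt_iff.1 (by rw [ha, ha]; exact f.strictMono h)
  have h32 : a 3 ≠ 32 := fun h => by
    have := f.lt_top
    rw [← ha, h, L.apply_top] at this
    exact this.false
  obtain ⟨k, h1, h2, h3⟩ := exists_flag_eq (a 0) (fun h => by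
    rw [← ha, h, L.apply_zero] at hlt
    exact hlt.false) (a 1) (hlt' (by decide)) (a 2) (hlt' (by decide)) fun h => by
      have := hlt' (i := 2) (j := 3) (by decide)
      rw [h, ← L.lt_iff, L.apply_top] at this
      exact this.not_ge le_top
  have h23 := hlt' (i := 2) (j := 3) (by decide)
  rcases eq_or_eq_of_flag_hle k (a 3) (h3 ▸ h23.1) with h | h
  · exact h23.2 (h3.symm.trans h.symm)
  · exact h32 h

theorem isCoatom_face_three (C : IsCell57 α) (f : Flag α) : IsCoatom (f.face 3) :=
  C.dual.isAtom_face_zero f.dual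

theorem exists_labelling (C : IsCell57 α) (f : Flag α) : ∃ (e : Fin 33 → α) (L : Labelling (f.face 0) e)
    (k : Fin 60), L.mkFlag (C.isAtom_face_zero f) k = f := by
  obtain ⟨e, L⟩ := C.up _ (C.isAtom_face_zero f)
  exact ⟨e, L, L.exists_mkFlag _ rfl⟩

theorem existsUnique_adj (C : IsCell57 α) (i : Fin 4) (f : Flag α) : ∃! g, f.Adj i g := by
  have key {β : Type _} [PartialOrder β] [BoundedOrder β] (C : IsCell57 β) (i : Fin 4)
      (hi : i ≠ 0) (f : Flag β) : ∃! g, f.Adj i g := by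
    obtain ⟨e, L, k, hk⟩ := C.exists_labelling f
    refine ⟨L.mkFlag (C.isAtom_face_zero f) (rho i k), ?_, fun g hg => ?_⟩
    · change f.Adj i _
      rw [← congrArg (Flag.Adj i · _) hk]
      exact (L.adj_mkFlag _).2 (flag_rho i hi k)
    · obtain ⟨l, rfl⟩ := L.exists_mkFlag (C.isAtom_face_zero f) ((hg 0).2 hi.symm).symm
      rw [← congrArg (Flag.Adj i · _) hk] at hg
      rw [eq_rho k l i ((L.adj_mkFlag _).1 hg)]
  rcases eq_or_ne i 0 with rfl | hi
  · obtain ⟨g, hg, hu⟩ := key C.dual 3 (by decide) f.dual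
    obtain ⟨g, rfl⟩ := Flag.dual.surjective g
    exact ⟨g, Flag.dual_adj (i := 0).1 hg, fun g' h => Flag.dual.injective
      (hu _ (Flag.dual_adj (i := 0).2 h))⟩
  · exact key C i hi f

/-- The flag adjacent to `f` in the face of rank `i`. -/
noncomputable def nbr (C : IsCell57 α) (i : Fin 4) (f : Flag α) : Flag α := (C.existsUnique_adj i f).choose

theorem adj_iff (C : IsCell57 α) {i : Fin 4} {f g : Flag α} : f.Adj i g ↔ C.nbr i f = g :=
  ⟨fun h => ((C.existsUnique_adj i f).choose_spec.2 g h).symm,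
    fun h => h ▸ (C.existsUnique_adj i f).choose_spec.1⟩

theorem adj_nbr (C : IsCell57 α) (i : Fin 4) (f : Flag α) : f.Adj i (C.nbr i f) := C.adj_iff.2 rfl

theorem nbr_involutive (C : IsCell57 α) (i : Fin 4) : Function.Involutive (C.nbr i) := fun f =>
  C.adj_iff.1 (C.adj_nbr i f).symm

theorem dual_run (C : IsCell57 α) (w : List (Fin 4)) (f : Flag α) :
    (run C.nbr w f).dual = run C.dual.nbr (w.map Fin.rev) f.dual := by
  induction w generalizing f with
  | nil => rfl
  | cons i w ih => rw [run_cons, ih, List.map_cons, run_cons,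
      C.dual.adj_iff.1 (Flag.dual_adj.2 (C.adj_nbr i f))]

theorem run_mkFlag (C : IsCell57 α) {x : α} {e : Fin 33 → α} (L : Labelling x e) (hx : IsAtom x)
    {w : List (Fin 4)} (hw : 0 ∉ w) (k : Fin 60) :
    run C.nbr w (L.mkFlag hx k) = L.mkFlag hx (run rho w k) := by
  induction w generalizing k with
  | nil => rfl
  | cons i w ih =>
    rw [List.mem_cons, not_or] at hw
    rw [run_cons, C.adj_iff.1 ((L.adj_mkFlag hx).2 (flag_rho i (Ne.symm hw.1) k)), ih hw.2, run_cons]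

theorem run_relator_of_zero_notMem (C : IsCell57 α) {w : List (Fin 4)} (hw : w ∈ relators) (h0 : 0 ∉ w)
    (f : Flag α) : run C.nbr w f = f := by
  obtain ⟨e, L, k, hk⟩ := C.exists_labelling f
  rw [← hk, C.run_mkFlag L _ h0, run_rho_relators w hw h0]

theorem nbr_face (C : IsCell57 α) {i j : Fin 4} (h : j ≠ i) (f : Flag α) : (C.nbr i f).face j = f.face j :=
  ((C.adj_nbr i f j).2 h).symm

theorem run_face (C : IsCell57 α) {w : List (Fin 4)} {i : Fin 4} (h : i ∉ w) (f : Flag α) :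
    (run C.nbr w f).face i = f.face i := by
  induction w generalizing f with
  | nil => rfl
  | cons j w ih =>
    rw [List.mem_cons, not_or] at h
    rw [run_cons, ih h.2, C.nbr_face h.1]

theorem nbr_zero_nbr_three (C : IsCell57 α) (f : Flag α) : C.nbr 0 (C.nbr 3 f) = C.nbr 3 (C.nbr 0 f) := by
  have h0 := C.adj_nbr 0 f
  have h3 := C.adj_nbr 3 f
  set p := C.nbr 0 f
  set q := C.nbr 3 f
  have e1 : p.face 1 = q.face 1 := by
    rw [← (h0 1).2 (by decide), ← (h3 1).2 (by decide)]
  have e2 : p.face 2 = q.face 2 := by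
    rw [← (h0 2).2 (by decide), ← (h3 2).2 (by decide)]
  have e0 : q.face 0 ≠ p.face 0 := fun h =>
    (h0 0).1 (((h3 0).2 (by decide)).trans h) rfl
  have e3 : p.face 3 ≠ q.face 3 := fun h =>
    (h3 3).1 (((h0 3).2 (by decide)).trans h) rfl
  let g := Flag.of (p.face 0) (p.face 1) (q.face 2) (q.face 3)
    ⟨p.lt_succ.1, p.lt_succ.2.1, e1 ▸ q.lt_succ.2.2.1, q.lt_succ.2.2.2⟩
  trans g
  · refine C.adj_iff.1 fun j => ?_
    fin_cases j <;> simp [g, Flag.of, e0, e1]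
  · refine (C.adj_iff.1 fun j => ?_).symm
    fin_cases j <;> simp [g, Flag.of, e3, e2]

theorem isRelAction_nbr (C : IsCell57 α) : IsRelAction C.nbr where
  invol := C.nbr_involutive
  rel w hw f := by
    by_cases h0 : 0 ∈ w
    · by_cases h3 : 3 ∈ w
      · have h : ∀ w ∈ relators, 0 ∈ w → 3 ∈ w → w = [0, 3, 0, 3] ∨ w = [3, 0, 3, 0] := by
          decide
        rcases h w hw h0 h3 with rfl | rfl
        · simp [C.nbr_zero_nbr_three, C.nbr_involutive _ _]
        · simp [← C.nbr_zero_nbr_three, C.nbr_involutive _ _]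
      · apply Flag.dual.injective
        rw [dual_run, C.dual.run_relator_of_zero_notMem]
        · exact (by decide : ∀ w ∈ relators, w.map Fin.rev ∈ relators) w hw
        · simpa [Fin.rev_eq_iff] using h3
    · exact C.run_relator_of_zero_notMem hw h0 f

/-- Two flags are joined by a path that keeps their common faces. -/
theorem exists_path_of_face_zero_eq (C : IsCell57 α) {f g : Flag α} (h : f.face 0 = g.face 0) :
    ∃ w, (∀ i ∈ w, f.face i ≠ g.face i) ∧ run C.nbr w f = g := by
  obtain ⟨e, L, k, hk⟩ := C.exists_labelling f
  obtain ⟨l, hl⟩ := L.exists_mkFlag (C.isAtom_face_zero f) h.symm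
  obtain ⟨w, h0, hw, hkl⟩ := exists_word k l
  refine ⟨w, fun i hi h => hw i hi (L.injective ?_), ?_⟩
  · rwa [← congrArg (Flag.face · i) hk, ← congrArg (Flag.face · i) hl] at h
  · conv_lhs => rw [← hk]
    rw [C.run_mkFlag L _ h0, hkl, hl]

theorem exists_path_of_face_one_eq (C : IsCell57 α) {f g : Flag α} (h : f.face 1 = g.face 1) :
    ∃ w, (∀ i ∈ w, f.face i ≠ g.face i) ∧ run C.nbr w f = g := by
  by_cases h0 : f.face 0 = g.face 0
  · exact C.exists_path_of_face_zero_eq h0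
  let p := Flag.of (f.face 0) (g.face 1) (g.face 2) (g.face 3)
    ⟨f.lt_succ.1, h ▸ f.lt_succ.2.1, g.lt_succ.2.2⟩
  obtain ⟨w, hw, hp⟩ := C.exists_path_of_face_zero_eq (f := f) (g := p) rfl
  have hpg : p.Adj 0 g := fun j => by fin_cases j <;> simp [p, Flag.of, h0]
  refine ⟨w ++ [0], fun i hi => ?_, ?_⟩
  · rcases List.mem_append.1 hi with hi | hi
    · by_cases hi0 : i = 0
      · exact hi0 ▸ h0
      · exact (hpg i).2 hi0 ▸ hw i hi
    · rwa [List.mem_singleton.1 hi]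
  · rw [run_append, hp, run_cons, run_nil, C.adj_iff.1 hpg]

theorem exists_path_of_dual (C : IsCell57 α) {f g : Flag α}
    (h : ∃ w, (∀ i ∈ w, f.dual.face i ≠ g.dual.face i) ∧ run C.dual.nbr w f.dual = g.dual) :
    ∃ w, (∀ i ∈ w, f.face i ≠ g.face i) ∧ run C.nbr w f = g := by
  obtain ⟨w, hw, h⟩ := h
  refine ⟨w.map Fin.rev, fun i hi => ?_, Flag.dual.injective ?_⟩
  · obtain ⟨j, hj, rfl⟩ := List.mem_map.1 hi
    exact hw j hj
  · rw [dual_run, List.map_map, (funext Fin.rev_rev : Fin.rev ∘ Fin.rev = id), List.map_id, h]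

theorem exists_run_eq (C : IsCell57 α) (f g : Flag α) : ∃ w, run C.nbr w f = g := by
  induction C.conn f g with
  | refl => exact ⟨[], rfl⟩
  | tail _ h ih =>
    obtain ⟨w, hw⟩ := ih
    obtain ⟨i, hi⟩ := h
    exact ⟨w ++ [i], by rw [run_append, hw, run_cons, run_nil, C.adj_iff.1 hi]⟩

theorem exists_path (C : IsCell57 α) (f g : Flag α) :
    ∃ w, (∀ i ∈ w, f.face i ≠ g.face i) ∧ run C.nbr w f = g := by
  by_cases h : ∃ i, f.face i = g.face i
  · obtain ⟨i, hi⟩ := h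
    fin_cases i
    · exact C.exists_path_of_face_zero_eq hi
    · exact C.exists_path_of_face_one_eq hi
    · exact C.exists_path_of_dual (C.dual.exists_path_of_face_one_eq hi)
    · exact C.exists_path_of_dual (C.dual.exists_path_of_face_zero_eq hi)
  · push Not at h
    obtain ⟨w, hw⟩ := C.exists_run_eq f g
    exact ⟨w, fun i _ => h i, hw⟩

theorem not_face_eq_of_lt (C : IsCell57 α) {f g : Flag α} {i j : Fin 4} (h : i < j) : f.face i ≠ g.face j := by
  intro hfg
  by_cases hi : i = 0
  · subst hi
    exact (g.bot_lt_face 0).ne' ((C.isAtom_face_zero f).2 _ (hfg ▸ g.strictMono h))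
  by_cases hj : j = 3
  · subst hj
    exact (f.face_lt_top 3).ne ((C.isCoatom_face_three g).2 _ (hfg ▸ f.strictMono h))
  obtain rfl : i = 1 := by omega
  obtain rfl : j = 2 := by omega
  have := C.isAtom_face_zero (Flag.of (g.face 1) (g.face 2) (f.face 2) (f.face 3)
    ⟨g.bot_lt_face 1, g.lt_succ.2.2.1, hfg ▸ f.lt_succ.2.2.1, f.lt_succ.2.2.2⟩)
  exact g.bot_lt.ne' (this.2 _ g.lt_succ.2.1)

theorem eq_of_face_eq (C : IsCell57 α) {f g : Flag α} {i j : Fin 4} (h : f.face i = g.face j) : i = j := by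
  rcases lt_trichotomy i j with hij | hij | hij
  · exact (C.not_face_eq_of_lt hij h).elim
  · exact hij
  · exact (C.not_face_eq_of_lt hij h.symm).elim

theorem exists_flag_of_le (C : IsCell57 α) {y z : α} (hy : y ≠ ⊥) (hz : z ≠ ⊤) (h : y ≤ z) :
    ∃ (f : Flag α) (i j : Fin 4), i ≤ j ∧ f.face i = y ∧ f.face j = z := by
  obtain ⟨x, hx, hxy⟩ := C.atomic y hy
  obtain ⟨e, L⟩ := C.up x hx
  obtain ⟨a, rfl⟩ := (L.range y).1 hxy
  obtain ⟨b, rfl⟩ := (L.range z).1 (hxy.trans h)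
  obtain ⟨k, i, j, rfl, rfl⟩ := exists_flag_of_hle a b ((L.le_iff a b).1 h)
    (fun hb => hz (hb ▸ L.apply_top))
  exact ⟨L.mkFlag hx k, i, j, (L.mkFlag hx k).strictMono.le_iff_le.1 h, rfl, rfl⟩

theorem exists_flag (C : IsCell57 α) {y : α} (hy : y ≠ ⊥) (hz : y ≠ ⊤) : ∃ (f : Flag α) (i : Fin 4), f.face i = y :=
  let ⟨f, i, _, _, h, _⟩ := C.exists_flag_of_le hy hz le_rfl
  ⟨f, i, h⟩

theorem eq_bot_or_eq_top_or_exists_flag (C : IsCell57 α) (y : α) :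
    y = ⊥ ∨ y = ⊤ ∨ ∃ (f : Flag α) (i : Fin 4), f.face i = y := by
  by_cases h : y = ⊥
  · exact .inl h
  by_cases h' : y = ⊤
  · exact .inr (.inl h')
  exact .inr (.inr (C.exists_flag h h'))

end IsCell57
end Poset
end Cell57

namespace Cell57

open OrderDual

theorem nine_dvd_card {X : Type*} [Finite X] [Nonempty X] {p : Equiv.Perm X} (h9 : p ^ 9 = 1)
    (h3 : ∀ x, (p ^ 3) x ≠ x) : 9 ∣ Nat.card X := by
  have hp : orderOf p = 3 ^ (1 + 1) := by
    have : Fact (Nat.Prime 3) := ⟨Nat.prime_three⟩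
    exact orderOf_eq_prime_pow (fun h => h3 (Classical.arbitrary X) (by
      rw [pow_one] at h
      rw [h, Equiv.Perm.one_apply])) h9
  have hfree : ∀ x : X, MulAction.stabilizer (Subgroup.zpowers p) x = ⊥ := by
    refine fun x => (Subgroup.eq_bot_iff_forall _).2 ?_
    rintro ⟨q, hq⟩ hx
    obtain ⟨n, rfl⟩ := mem_powers_iff_mem_zpowers.2 hq
    have hx : (p ^ n) x = x := hx
    rw [← Equiv.Perm.iterate_eq_pow] at hx
    have hx' : Function.IsPeriodicPt p 9 x := by
      rw [Function.IsPeriodicPt, Function.IsFixedPt, Equiv.Perm.iterate_eq_pow, h9,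
        Equiv.Perm.one_apply]
    have hper : Function.minimalPeriod p x = 3 ^ (1 + 1) := by
      have : Fact (Nat.Prime 3) := ⟨Nat.prime_three⟩
      refine Function.minimalPeriod_eq_prime_pow (fun h => h3 x ?_) hx'
      rwa [Function.IsPeriodicPt, Function.IsFixedPt, Equiv.Perm.iterate_eq_pow] at h
    have hn := Function.IsPeriodicPt.minimalPeriod_dvd hx
    rw [hper, ← hp, orderOf_dvd_iff_pow_eq_one] at hn
    exact Subtype.ext hn
  have := Nat.card_congr (MulAction.selfEquivOrbitsQuotientProd hfree)
  rw [this, Nat.card_prod, Nat.card_zpowers, hp]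
  exact Dvd.intro_left _ rfl

section Poset

variable {α : Type*} [PartialOrder α] [BoundedOrder α]

/-- The group element acting as a word. -/
def wordElt (w : List (Fin 4)) : Grp := (w.map gen).reverse.prod

namespace IsCell57

/-- Passing to the `i`-adjacent flag, as a permutation. -/
noncomputable def nbrPerm (C : IsCell57 α) (i : Fin 4) : Equiv.Perm (Flag α) :=
  (C.nbr_involutive i).toPerm _

theorem prod_nbrPerm (C : IsCell57 α) (w : List (Fin 4)) (f : Flag α) :
    (w.map C.nbrPerm).reverse.prod f = run C.nbr w f :=
  (run_eq_smul C.nbrPerm w f).symm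

/-- The action of the group on flags. -/
noncomputable def hom (C : IsCell57 α) : Grp →* Equiv.Perm (Flag α) :=
  PresentedGroup.toGroup (f := C.nbrPerm) (by
    rintro _ (⟨i, rfl⟩ | ⟨w, hw, rfl⟩)
    · ext1 f
      rw [map_mul, FreeGroup.lift_apply_of]
      exact C.nbr_involutive i f
    · ext1 f
      rw [map_list_prod, List.map_reverse, List.map_map]
      have := C.prod_nbrPerm w f
      rw [C.isRelAction_nbr.rel w hw] at this
      simpa [Function.comp_def] using this)

theorem hom_gen (C : IsCell57 α) (i : Fin 4) : C.hom (gen i) = C.nbrPerm i :=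
  PresentedGroup.toGroup.of _

theorem hom_wordElt (C : IsCell57 α) (w : List (Fin 4)) (f : Flag α) :
    C.hom (wordElt w) f = run C.nbr w f := by
  rw [← prod_nbrPerm, wordElt, map_list_prod, List.map_reverse, List.map_map]
  exact congrArg (fun g : Fin 4 → Equiv.Perm (Flag α) => (w.map g).reverse.prod f) (funext C.hom_gen)

theorem exists_hom_eq (C : IsCell57 α) (f g : Flag α) : ∃ x, C.hom x f = g := by
  obtain ⟨w, hw⟩ := C.exists_run_eq f g
  exact ⟨wordElt w, (C.hom_wordElt w f).trans hw⟩

theorem nonempty_flag (C : IsCell57 α) : Nonempty (Flag α) := by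
  obtain ⟨x, hx, -⟩ := C.atomic ⊤ C.bot_ne_top.symm
  obtain ⟨e, L⟩ := C.up x hx
  exact ⟨L.mkFlag hx 0⟩

theorem finite_flag (C : IsCell57 α) : Finite (Flag α) := by
  have := card_grp_le.1
  obtain ⟨f⟩ := C.nonempty_flag
  exact Finite.of_surjective (fun x => C.hom x f) (C.exists_hom_eq f)

theorem card_flag (C : IsCell57 α) : Nat.card (Flag α) = Nat.card {x : α // IsAtom x} * 60 := by
  choose e L using C.up
  have h : Function.Bijective fun p : {x : α // IsAtom x} × Fin 60 =>
      (L p.1 p.1.2).mkFlag p.1.2 p.2 := by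
    constructor
    · rintro ⟨⟨x, hx⟩, k⟩ ⟨⟨y, hy⟩, l⟩ h
      obtain rfl : x = y := by
        have := congrArg (fun f => f.face 0) h
        simpa only [Labelling.mkFlag_face_zero] using this
      exact congrArg _ ((L x hx).mkFlag_injective hx h)
    · intro f
      obtain ⟨k, hk⟩ := (L _ (C.isAtom_face_zero f)).exists_mkFlag (C.isAtom_face_zero f) rfl
      exact ⟨⟨⟨_, C.isAtom_face_zero f⟩, k⟩, hk⟩
  rw [← Nat.card_congr (Equiv.ofBijective _ h), Nat.card_prod, Nat.card_fin]

theorem four_le_card_atom (C : IsCell57 α) : 4 ≤ Nat.card {x : α // IsAtom x} := by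
  obtain ⟨f⟩ := C.nonempty_flag
  obtain ⟨e, L⟩ := C.down _ (C.isCoatom_face_three f)
  have hx := (C.isCoatom_face_three f).dual
  have ha (k : Fin 60) : IsAtom (ofDual (e (flag k 3))) :=
    C.dual.isCoatom_face_three (L.mkFlag hx k)
  obtain ⟨h0, ⟨k1, h1⟩, ⟨k2, h2⟩, ⟨k3, h3⟩⟩ := exists_four_flags
  have := C.finite_flag
  have : Finite {x : α // IsAtom x} := Finite.of_surjective
    (fun f : Flag α => ⟨f.face 0, C.isAtom_face_zero f⟩) fun ⟨x, hx⟩ => by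
      obtain ⟨e, L⟩ := C.up x hx
      exact ⟨L.mkFlag hx 0, Subtype.ext (L.mkFlag_face_zero hx 0)⟩
  have hv (i : Fin 4) : IsAtom (ofDual (e (![22, 23, 24, 25] i))) := by
    fin_cases i
    exacts [h0 ▸ ha 0, h1 ▸ ha k1, h2 ▸ ha k2, h3 ▸ ha k3]
  have hinj : Function.Injective fun i : Fin 4 => (⟨_, hv i⟩ : {x : α // IsAtom x}) :=
    fun i j h => (by decide : Function.Injective (![22, 23, 24, 25] : Fin 4 → Fin 33))
      (L.injective (congrArg Subtype.val h))
  simpa using Nat.card_le_card_of_injective _ hinj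

theorem run_one_two_ne (C : IsCell57 α) (f : Flag α) : run C.nbr [1, 2] f ≠ f := by
  intro h
  have h1 := C.adj_nbr 1 f
  have h2 := (C.adj_nbr 2 (C.nbr 1 f)).symm
  rw [show C.nbr 2 (C.nbr 1 f) = f from h] at h2
  exact (h2 2).1 ((h1 2).2 (by decide)) rfl


/-! ### Counting flags -/

theorem card_atom (C : IsCell57 α) (hG : Nat.card Grp = 3420)
    (h9 : wordElt [0, 1, 2, 3] ^ 9 = 1)
    (h3 : wordElt [0, 1, 2, 3] ^ 3 =
      (wordElt [1, 2, 1, 0, 3])⁻¹ * wordElt [1, 2] * wordElt [1, 2, 1, 0, 3]) :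
    Nat.card {x : α // IsAtom x} = 57 := by
  have hfin := C.finite_flag
  obtain ⟨f⟩ := C.nonempty_flag
  have hdvd : Nat.card (Flag α) ∣ 3420 := by
    let _ : MulAction Grp (Flag α) := MulAction.compHom _ C.hom
    have : MulAction.IsPretransitive Grp (Flag α) := ⟨C.exists_hom_eq⟩
    rw [← hG]
    rw [← MulAction.index_stabilizer_of_transitive Grp f]
    exact Subgroup.index_dvd_card _
  have h9dvd : 9 ∣ Nat.card (Flag α) := by
    have : Nonempty (Flag α) := ⟨f⟩
    refine nine_dvd_card (p := C.hom (wordElt [0, 1, 2, 3])) (by rw [← map_pow, h9, map_one]) ?_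
    intro g hg
    rw [← map_pow, h3, map_mul, map_mul, map_inv, Equiv.Perm.mul_apply, Equiv.Perm.mul_apply,
      Equiv.Perm.inv_eq_iff_eq, hom_wordElt] at hg
    exact C.run_one_two_ne _ hg
  have h4 := C.four_le_card_atom
  rw [C.card_flag] at hdvd h9dvd
  have h57 : Nat.card {x : α // IsAtom x} ∣ 57 := by
    refine Nat.dvd_of_mul_dvd_mul_right (k := 60) (by norm_num) hdvd
  have h3 : 3 ∣ Nat.card {x : α // IsAtom x} := by omega
  obtain ⟨m, hm⟩ := h57
  have : Nat.card {x : α // IsAtom x} ≤ 57 := Nat.le_of_dvd (by norm_num) ⟨m, hm⟩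
  have hm : m < 15 := by
    by_contra! h
    nlinarith
  interval_cases m <;> omega

end IsCell57

/-! ### Isomorphisms from flags -/

variable {β : Type*} [PartialOrder β] [BoundedOrder β]

/-- The map on faces induced by a map on flags. -/
noncomputable def faceMap (θ : Flag α → Flag β) (y : α) : β := by
  classical
  exact if h : ∃ p : Flag α × Fin 4, p.1.face p.2 = y then (θ h.choose.1).face h.choose.2
    else if y = ⊥ then ⊥ else ⊤

theorem faceMap_bot (θ : Flag α → Flag β) : faceMap θ ⊥ = ⊥ := by
  rw [faceMap, dif_neg, if_pos rfl]
  rintro ⟨p, hp⟩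
  exact (p.1.bot_lt_face p.2).ne' hp

theorem faceMap_top (h : (⊥ : α) ≠ ⊤) (θ : Flag α → Flag β) : faceMap θ ⊤ = ⊤ := by
  rw [faceMap, dif_neg, if_neg h.symm]
  rintro ⟨p, hp⟩
  exact (p.1.face_lt_top p.2).ne hp

theorem IsCell57.faceMap_face (C : IsCell57 α) (D : IsCell57 β) {θ : Flag α → Flag β}
    (hθ : ∀ i f, θ (C.nbr i f) = D.nbr i (θ f)) (f : Flag α) (i : Fin 4) :
    faceMap θ (f.face i) = (θ f).face i := by
  have h : ∃ p : Flag α × Fin 4, p.1.face p.2 = f.face i := ⟨(f, i), rfl⟩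
  rw [faceMap, dif_pos h]
  have hp := h.choose_spec
  set p := h.choose
  have hi := C.eq_of_face_eq hp
  rw [hi] at hp ⊢
  obtain ⟨w, hw, hr⟩ := C.exists_path p.1 f
  have hrun (w : List (Fin 4)) (g : Flag α) : θ (run C.nbr w g) = run D.nbr w (θ g) := by
    induction w generalizing g with
    | nil => rfl
    | cons j w ih => rw [run_cons, ih, hθ, run_cons]
  rw [← hr, hrun, D.run_face fun hmem => hw i hmem hp]

theorem IsCell57.faceMap_monotone (C : IsCell57 α) (D : IsCell57 β) {θ : Flag α → Flag β}
    (hθ : ∀ i f, θ (C.nbr i f) = D.nbr i (θ f)) : Monotone (faceMap θ) := by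
  intro y z h
  by_cases hy : y = ⊥
  · rw [hy, faceMap_bot]
    exact bot_le
  by_cases hz : z = ⊤
  · rw [hz, faceMap_top C.bot_ne_top]
    exact le_top
  obtain ⟨f, i, j, hij, rfl, rfl⟩ := C.exists_flag_of_le hy hz h
  rw [C.faceMap_face D hθ, C.faceMap_face D hθ]
  exact (θ f).strictMono.monotone hij

theorem IsCell57.faceMap_faceMap (C : IsCell57 α) (D : IsCell57 β) {θ : Flag α → Flag β}
    {η : Flag β → Flag α} (hθ : ∀ i f, θ (C.nbr i f) = D.nbr i (θ f))
    (hη : ∀ i f, η (D.nbr i f) = C.nbr i (η f)) (h : ∀ f, η (θ f) = f) (y : α) :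
    faceMap η (faceMap θ y) = y := by
  rcases C.eq_bot_or_eq_top_or_exists_flag y with rfl | rfl | ⟨f, i, rfl⟩
  · rw [faceMap_bot, faceMap_bot]
  · rw [faceMap_top C.bot_ne_top, faceMap_top D.bot_ne_top]
  · rw [C.faceMap_face D hθ, D.faceMap_face C hη, h]

/-- An adjacency preserving bijection between flags comes from an isomorphism. -/
theorem IsCell57.exists_orderIso (C : IsCell57 α) (D : IsCell57 β) (θ : Flag α ≃ Flag β)
    (hθ : ∀ i f, θ (C.nbr i f) = D.nbr i (θ f)) :
    ∃ φ : α ≃o β, ∀ f i, φ (f.face i) = (θ f).face i := by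
  have hη (i : Fin 4) (f : Flag β) : θ.symm (D.nbr i f) = C.nbr i (θ.symm f) := by
    rw [Equiv.symm_apply_eq, hθ, Equiv.apply_symm_apply]
  let φ : α ≃ β := ⟨faceMap θ, faceMap θ.symm,
    C.faceMap_faceMap D hθ hη θ.symm_apply_apply, D.faceMap_faceMap C hη hθ θ.apply_symm_apply⟩
  exact ⟨φ.toOrderIso (C.faceMap_monotone D hθ) (D.faceMap_monotone C hη), C.faceMap_face D hθ⟩

/-- The image of a flag under an isomorphism. -/
def Flag.map (φ : α ≃o β) (f : Flag α) : Flag β where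
  face i := φ (f.face i)
  strictMono := φ.strictMono.comp f.strictMono
  bot_lt := by rw [← map_bot φ]; exact φ.strictMono f.bot_lt
  lt_top := by rw [← map_top φ]; exact φ.strictMono f.lt_top

theorem IsCell57.map_nbr (C : IsCell57 α) (D : IsCell57 β) (φ : α ≃o β) (i : Fin 4) (f : Flag α) :
    (C.nbr i f).map φ = D.nbr i (f.map φ) :=
  (D.adj_iff.1 fun j => φ.injective.eq_iff.trans (C.adj_nbr i f j)).symm

/-- Isomorphisms are determined by the image of one flag. -/
theorem IsCell57.orderIso_ext (C : IsCell57 α) (D : IsCell57 β) {φ ψ : α ≃o β} {f : Flag α}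
    (h : f.map φ = f.map ψ) : φ = ψ := by
  have hrun (w : List (Fin 4)) : ∀ f : Flag α, f.map φ = f.map ψ →
      (run C.nbr w f).map φ = (run C.nbr w f).map ψ := by
    induction w with
    | nil => exact fun _ h => h
    | cons i w ih => exact fun f h => ih _ (by rw [C.map_nbr D, C.map_nbr D, h])
  ext y
  rcases C.eq_bot_or_eq_top_or_exists_flag y with rfl | rfl | ⟨g, i, rfl⟩
  · rw [map_bot, map_bot]
  · rw [map_top, map_top]
  · obtain ⟨w, rfl⟩ := C.exists_run_eq f g
    exact congrArg (fun f => f.face i) (hrun w f h)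

theorem IsCell57.bijective_hom (C : IsCell57 α) (hC : Nat.card Grp ≤ Nat.card (Flag α))
    (f : Flag α) : Function.Bijective fun x => C.hom x f :=
  have := card_grp_le.1
  Function.Surjective.bijective_of_nat_card_le (C.exists_hom_eq f) hC

/-- If the group acts regularly on the flags of both posets, any pair of flags determines an
isomorphism. -/
theorem IsCell57.exists_map_eq (C : IsCell57 α) (D : IsCell57 β)
    (hC : Nat.card Grp ≤ Nat.card (Flag α)) (hD : Nat.card Grp ≤ Nat.card (Flag β))
    (f : Flag α) (g : Flag β) : ∃ φ : α ≃o β, f.map φ = g := by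
  let a := Equiv.ofBijective _ (C.bijective_hom hC f)
  let b := Equiv.ofBijective _ (D.bijective_hom hD g)
  obtain ⟨φ, hφ⟩ := C.exists_orderIso D (a.symm.trans b) (by
    intro i f'
    obtain ⟨x, rfl⟩ := a.surjective f'
    have ha : C.nbr i (a x) = a (gen i * x) := by
      simp only [a, Equiv.ofBijective_apply, map_mul, hom_gen]
      rfl
    rw [ha, Equiv.trans_apply, Equiv.trans_apply, Equiv.symm_apply_apply, Equiv.symm_apply_apply]
    simp only [b, Equiv.ofBijective_apply, map_mul, hom_gen]
    rfl)
  refine ⟨φ, Flag.ext (funext fun i => (hφ f i).trans ?_)⟩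
  have ha : f = a 1 := by simp [a]
  have hb : g = b 1 := by simp [b]
  rw [Equiv.trans_apply, ha, Equiv.symm_apply_apply, ← hb]

theorem IsCell57.wordElt_eq (C : IsCell57 α) (hC : Nat.card Grp ≤ Nat.card (Flag α))
    {w w' : List (Fin 4)} (f : Flag α) (h : run C.nbr w f = run C.nbr w' f) :
    wordElt w = wordElt w' := by
  apply (C.bijective_hom hC f).injective
  change C.hom _ f = C.hom _ f
  rw [hom_wordElt, hom_wordElt, h]

/-- The facts about the group that determine the flags of the 57-cell. -/
structure GrpFacts : Prop where
  card : Nat.card Grp = 3420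
  pow_nine : wordElt [0, 1, 2, 3] ^ 9 = 1
  pow_three : wordElt [0, 1, 2, 3] ^ 3 =
    (wordElt [1, 2, 1, 0, 3])⁻¹ * wordElt [1, 2] * wordElt [1, 2, 1, 0, 3]

theorem wordElt_append (w w' : List (Fin 4)) : wordElt (w ++ w') = wordElt w' * wordElt w := by
  simp [wordElt]

theorem wordElt_reverse (w : List (Fin 4)) : wordElt w.reverse = (wordElt w)⁻¹ := by
  induction w with
  | nil => simp [wordElt]
  | cons i w ih =>
    rw [List.reverse_cons, wordElt_append, ih, show i :: w = [i] ++ w from rfl, wordElt_append,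
      mul_inv_rev]
    simp [wordElt, gen_inv]

theorem wordElt_flatten_replicate (w : List (Fin 4)) (n : ℕ) :
    wordElt (List.replicate n w).flatten = wordElt w ^ n := by
  induction n with
  | zero => simp [wordElt]
  | succ n ih => rw [List.replicate_succ, List.flatten_cons, wordElt_append, ih, pow_succ]

theorem IsCell57.grpFacts (C : IsCell57 α) (hC : 3420 ≤ Nat.card (Flag α)) (f : Flag α)
    (h9 : run C.nbr (List.replicate 9 [0, 1, 2, 3]).flatten f = f)
    (h3 : run C.nbr (List.replicate 3 [0, 1, 2, 3]).flatten f =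
      run C.nbr ([1, 2, 1, 0, 3] ++ ([1, 2] ++ [1, 2, 1, 0, 3].reverse)) f) : GrpFacts where
  card := by
    obtain ⟨_, h⟩ := card_grp_le
    have := Nat.card_le_card_of_surjective _ (C.exists_hom_eq f)
    omega
  pow_nine := by
    rw [← wordElt_flatten_replicate]
    exact C.wordElt_eq (card_grp_le.2.trans hC) (w' := []) f h9
  pow_three := by
    rw [← wordElt_flatten_replicate, C.wordElt_eq (card_grp_le.2.trans hC) f h3, wordElt_append,
      wordElt_append, wordElt_reverse]

theorem IsCell57.card_grp_le_card_flag (C : IsCell57 α) (G : GrpFacts) :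
    Nat.card Grp ≤ Nat.card (Flag α) := by
  rw [C.card_flag, C.card_atom G.card G.pow_nine G.pow_three, G.card]

theorem IsCell57.nonempty_orderIso (C : IsCell57 α) (D : IsCell57 β) (G : GrpFacts) :
    Nonempty (α ≃o β) := by
  obtain ⟨f⟩ := C.nonempty_flag
  obtain ⟨g⟩ := D.nonempty_flag
  obtain ⟨φ, -⟩ := C.exists_map_eq D (C.card_grp_le_card_flag G) (D.card_grp_le_card_flag G) f g
  exact ⟨φ⟩

theorem IsCell57.card_orderIso (C : IsCell57 α) (G : GrpFacts) : Nat.card (α ≃o α) = 3420 := by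
  obtain ⟨f⟩ := C.nonempty_flag
  have h : Function.Bijective fun φ : α ≃o α => f.map φ :=
    ⟨fun _ _ h => C.orderIso_ext C h,
      C.exists_map_eq C (C.card_grp_le_card_flag G) (C.card_grp_le_card_flag G) f⟩
  rw [Nat.card_congr (Equiv.ofBijective _ h), C.card_flag,
    C.card_atom G.card G.pow_nine G.pow_three]

theorem IsCell57.card_coatom (C : IsCell57 α) (G : GrpFacts) :
    Nat.card {x : α // IsCoatom x} = 57 :=
  C.dual.card_atom G.card G.pow_nine G.pow_three

end Poset
end Cell57

namespace Cell57

/-! ### A model of the 57-cell -/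

section Model

/-- The proper faces of the 57-cell. The cyclic group of order 19 acts freely on them; there are
three orbits of vertices, nine of edges, nine of pentagons and three of facets. -/
@[ext]
structure Face : Type u where
  /-- The orbit of the face. -/
  orbit : Fin 24
  /-- The position of the face in its orbit. -/
  pos : Fin 19

instance : DecidableEq Face.{u} := fun _ _ => decidable_of_iff _ Face.ext_iff.symm

/-- The facets `⟨21 + i, d⟩` containing the face at position `0` of each orbit, as pairs `(i, d)`. -/
def facetsAbove (o : Fin 24) : List (Fin 3 × Fin 19) :=
  [[(0, 0), (0, 1), (0, 9), (0, 13), (1, 0), (1, 1), (1, 8), (2, 0), (2, 9), (2, 15)], [(0,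
   0), (0, 1), (0, 8), (1, 0), (1, 5), (1, 7), (1, 8), (2, 0), (2, 14), (2, 16)], [(0, 0), (0,
   9), (0, 15), (1, 0), (1, 14), (1, 16), (2, 6), (2, 9), (2, 11), (2, 15)], [(0, 0), (0, 1),
   (1, 0), (1, 8), (2, 0)], [(0, 0), (0, 9), (1, 0), (2, 9), (2, 15)], [(0, 0), (0, 8), (1,
   0), (1, 7), (2, 14)], [(0, 0), (1, 0), (1, 16), (2, 6), (2, 11)], [(0, 0), (0, 12), (1, 0),
   (1, 18), (2, 8)], [(0, 0), (0, 13), (1, 1), (2, 0), (2, 15)], [(0, 0), (1, 5), (1, 7), (2,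
   0), (2, 16)], [(0, 0), (0, 4), (1, 18), (2, 0), (2, 10)], [(0, 0), (1, 4), (1, 18), (2,
   13), (2, 15)], [(0, 0), (1, 0)], [(0, 0), (2, 0)], [(0, 0), (2, 15)], [(0, 0), (1, 7)],
   [(0, 0), (2, 6)], [(0, 0), (1, 18)], [(1, 0), (2, 9)], [(1, 0), (2, 14)], [(1, 0), (2,
   11)], [(0, 0)], [(1, 0)], [(2, 0)]].getD o []

/-- The rank of the faces of an orbit. -/
def orbitRank (o : Fin 24) : Fin 4 := if o < 3 then 0 else if o < 12 then 1 else if o < 21 then 2 else 3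

namespace Face

/-- Incidence of faces: every facet containing `b` contains `a`. -/
def below (a b : Face.{u}) : Bool :=
  decide (orbitRank a.orbit < orbitRank b.orbit) && (facetsAbove b.orbit).all fun d =>
    (facetsAbove a.orbit).contains (d.1, d.2 + (b.pos - a.pos))

theorem below_trans {a b c : Face.{u}} (hab : below a b) (hbc : below b c) : below a c := by
  simp only [below, Bool.and_eq_true, decide_eq_true_eq, List.all_eq_true, List.contains_iff_mem]
    at *
  refine ⟨hab.1.trans hbc.1, fun d hd => ?_⟩
  have := hab.2 _ (hbc.2 d hd)
  rwa [add_assoc, sub_add_sub_cancel] at this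

theorem orbitRank_lt {a b : Face.{u}} (h : below a b) : orbitRank a.orbit < orbitRank b.orbit := by
  simp only [below, Bool.and_eq_true, decide_eq_true_eq] at h
  exact h.1

instance : PartialOrder Face.{u} where
  le a b := a = b ∨ below a b
  le_refl a := .inl rfl
  le_trans a b c := by
    rintro (rfl | h) (rfl | h')
    exacts [.inl rfl, .inr h', .inr h, .inr (below_trans h h')]
  le_antisymm a b := by
    rintro (rfl | h) (h' | h')
    exacts [rfl, rfl, h'.symm, absurd (orbitRank_lt h) (orbitRank_lt h').not_gt]

theorem le_iff {a b : Face.{u}} : a ≤ b ↔ a = b ∨ below a b := Iff.rfl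

theorem lt_iff {a b : Face.{u}} : a < b ↔ below a b := by
  rw [lt_iff_le_and_ne, le_iff]
  refine ⟨fun h => h.1.resolve_left h.2, fun h => ⟨.inr h, ?_⟩⟩
  rintro rfl
  exact (orbitRank_lt h).false

instance : DecidableLE Face.{u} := fun _ _ => inferInstanceAs (Decidable (_ ∨ _))

instance : DecidableLT Face.{u} := fun _ _ => decidable_of_iff _ lt_iff.symm

/-- Rotation of the 57-cell. -/
def rot (j : Fin 19) (a : Face.{u}) : Face.{u} := ⟨a.orbit, a.pos + j⟩

theorem rot_le_rot {j : Fin 19} {a b : Face.{u}} : rot j a ≤ rot j b ↔ a ≤ b := by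
  simp [le_iff, below, rot, Face.ext_iff]

theorem rot_rot_neg (j : Fin 19) (a : Face.{u}) : rot j (rot (-j) a) = a := by
  simp [rot]

/-- The face with given number. -/
def ofCode (c : ℕ) : Face.{u} := ⟨Fin.ofNat 24 (c / 19), Fin.ofNat 19 (c % 19)⟩

/-- The faces containing the vertex `⟨o, 0⟩`. -/
def upper (o : Fin 3) (a : Fin 33) : Face.{u} :=
  ofCode ((
  [[0, 57, 76, 152, 134, 96, 199, 228, 247, 286, 324, 388, 266, 256, 342, 313, 298, 362, 317,
   229, 279, 332, 399, 418, 437, 400, 426, 452, 446, 408, 419, 412], [19, 57, 95, 171, 210,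
   141, 122, 228, 247, 286, 324, 388, 285, 312, 361, 331, 385, 349, 366, 267, 347, 236, 399,
   418, 437, 400, 426, 425, 451, 407, 453, 423], [38, 76, 114, 205, 224, 180, 167, 228, 266,
   256, 342, 313, 304, 377, 380, 358, 338, 394, 262, 375, 281, 294, 399, 418, 452, 446, 408,
   443, 448, 434, 432, 414]].getD o []).getD a 0)

/-- The faces contained in the facet `⟨21 + o, 0⟩`. -/
def lower (o : Fin 3) (a : Fin 33) : Face.{u} :=
  ofCode ((
  [[399, 228, 247, 266, 285, 323, 304, 57, 76, 133, 95, 114, 152, 86, 171, 190, 140, 209, 205,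
   75, 158, 106, 0, 19, 38, 18, 30, 42, 48, 10, 37, 6], [418, 228, 324, 342, 361, 297, 380,
   57, 76, 133, 95, 114, 134, 191, 210, 107, 117, 183, 224, 170, 185, 68, 0, 19, 38, 18, 30,
   31, 43, 11, 41, 33], [437, 247, 388, 317, 366, 352, 270, 57, 152, 86, 171, 190, 199, 213,
   122, 174, 100, 127, 80, 215, 156, 144, 0, 19, 42, 48, 10, 51, 46, 22, 24, 4]].getD o []).getD a 0)

theorem upper_zero : ∀ o : Fin 3, upper o 0 = (⟨o.castLE (by decide), 0⟩ : Face.{u}) := by decide +kernel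

theorem lower_zero : ∀ o : Fin 3, lower o 0 = (⟨o.natAdd 21, 0⟩ : Face.{u}) := by decide +kernel

theorem upper_le_upper : ∀ (o : Fin 3) (a b : Fin 33), a ≠ 32 → b ≠ 32 →
    (upper.{u} o a ≤ upper o b ↔ hle a b) := by decide +kernel

theorem lower_le_lower : ∀ (o : Fin 3) (a b : Fin 33), a ≠ 32 → b ≠ 32 →
    (lower.{u} o b ≤ lower o a ↔ hle a b) := by decide +kernel

theorem exists_upper_eq : ∀ (o : Fin 3) (p : Fin 24) (j : Fin 19),
    (⟨o.castLE (by decide), 0⟩ : Face.{u}) ≤ ⟨p, j⟩ → ∃ a ≠ 32, upper o a = (⟨p, j⟩ : Face.{u}) := by decide +kernel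

theorem exists_lower_eq : ∀ (o : Fin 3) (p : Fin 24) (j : Fin 19),
    (⟨p, j⟩ : Face.{u}) ≤ ⟨o.natAdd 21, 0⟩ → ∃ a ≠ 32, lower o a = (⟨p, j⟩ : Face.{u}) := by decide +kernel

theorem exists_vertex_le : ∀ (p : Fin 24), ∃ (o : Fin 3) (j : Fin 19),
    (⟨o.castLE (by decide), j⟩ : Face.{u}) ≤ ⟨p, 0⟩ := by decide +kernel

theorem exists_le_facet : ∀ (p : Fin 24), ∃ (o : Fin 3) (j : Fin 19),
    (⟨p, 0⟩ : Face.{u}) ≤ ⟨o.natAdd 21, j⟩ := by decide +kernel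

end Face

end Model

end Cell57

namespace Cell57

open OrderDual

section Connected

variable {α : Type*} [PartialOrder α] [BoundedOrder α]

/-- A labelling of the proper faces above `x` extends to all faces above `x`. -/
theorem Labelling.of_ne_top {x : α} {e : Fin 33 → α}
    (hle' : ∀ a b, a ≠ 32 → b ≠ 32 → (e a ≤ e b ↔ hle a b)) (htop : ∀ a, e a ≠ ⊤)
    (h0 : e 0 = x) (hr : ∀ y ≠ ⊤, x ≤ y → ∃ a ≠ 32, e a = y) :
    Labelling x fun a => if a = 32 then ⊤ else e a where
  le_iff a b := by
    by_cases hb : b = 32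
    · simp [hb, hle_top]
    by_cases ha : a = 32
    · subst ha
      simp only [if_true, hb, if_false, top_le_iff, htop, false_iff]
      exact fun h => hb (hle_antisymm _ _ (hle_top b) h)
    · simp [ha, hb, hle' a b]
  range y := by
    constructor
    · intro hy
      by_cases h : y = ⊤
      · exact ⟨32, by simp [h]⟩
      · obtain ⟨a, ha, rfl⟩ := hr y h hy
        exact ⟨a, if_neg ha⟩
    · rintro ⟨a, rfl⟩
      by_cases ha : a = 32
      · simp [ha]
      · simp only [ha, if_false, ← h0]
        exact (hle' 0 a (by decide) ha).2 (bot_hle a)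

/-- Two flags in the same component of the flag graph. -/
def Flag.Linked : Flag α → Flag α → Prop := Relation.ReflTransGen fun f g => ∃ i, Flag.Adj i f g

theorem Flag.Linked.symm {f g : Flag α} (h : f.Linked g) : g.Linked f := by
  induction h with
  | refl => exact .refl
  | tail _ h ih =>
    obtain ⟨i, h⟩ := h
    exact .head ⟨i, h.symm⟩ ih

theorem Flag.Linked.dual {f g : Flag αᵒᵈ} (h : f.Linked g) :
    (Flag.dual.symm f).Linked (Flag.dual.symm g) :=
  h.lift Flag.dual.symm fun f g ⟨i, h⟩ => ⟨i.rev, Flag.dual_adj.1 (by simpa using h)⟩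

theorem Labelling.linked {x : α} {e : Fin 33 → α} (L : Labelling x e) (hx : IsAtom x)
    {f g : Flag α} (hf : f.face 0 = x) (hg : g.face 0 = x) : f.Linked g := by
  obtain ⟨k, rfl⟩ := L.exists_mkFlag hx hf
  obtain ⟨l, rfl⟩ := L.exists_mkFlag hx hg
  obtain ⟨w, h0, -, rfl⟩ := exists_word k l
  clear hf hg
  induction w generalizing k with
  | nil => exact .refl
  | cons i w ih =>
    rw [List.mem_cons, not_or] at h0
    exact .head ⟨i, (L.adj_mkFlag hx).2 (flag_rho i (Ne.symm h0.1) k)⟩ (ih _ h0.2)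

theorem Labelling.linked_dual {x : α} {e : Fin 33 → αᵒᵈ} (L : Labelling (toDual x) e)
    (hx : IsCoatom x) {f g : Flag α} (hf : f.face 3 = x) (hg : g.face 3 = x) : f.Linked g := by
  simpa using (L.linked hx.dual (f := f.dual) (g := g.dual) (congrArg toDual hf)
    (congrArg toDual hg)).dual

theorem Labelling.exists_flag {x y : α} {e : Fin 33 → α} (L : Labelling x e) (hx : IsAtom x)
    (hy : IsCoatom y) (h : x ≤ y) : ∃ f : Flag α, f.face 0 = x ∧ f.face 3 = y := by
  obtain ⟨b, rfl⟩ := (L.range y).1 h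
  obtain ⟨k, -, j, -, rfl⟩ := exists_flag_of_hle 0 b (bot_hle b) fun h => hy.1 (h ▸ L.apply_top)
  let f := L.mkFlag hx k
  exact ⟨f, L.mkFlag_face_zero hx k,
    ((hy.le_iff.1 (f.strictMono.monotone (Fin.le_last j))).resolve_left f.lt_top.ne)⟩

end Connected

section Model

/-- The face poset of the 57-cell. -/
abbrev Model : Type u := WithBot (WithTop Face.{u})

namespace Model

/-- A proper face. -/
abbrev mk (a : Face.{u}) : Model.{u} := ((a : WithTop Face.{u}) : Model.{u})

theorem mk_le_mk {a b : Face.{u}} : mk a ≤ mk b ↔ a ≤ b := by simp [mk]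

theorem mk_lt_mk {a b : Face.{u}} : mk a < mk b ↔ a < b := by simp [mk]

theorem mk_injective : Function.Injective mk.{u} := fun a b h => by simpa [mk] using h

theorem mk_ne_bot (a : Face.{u}) : mk a ≠ ⊥ := WithBot.coe_ne_bot

theorem mk_ne_top (a : Face.{u}) : mk a ≠ ⊤ := fun h => WithTop.coe_ne_top (WithBot.coe_injective h)

theorem exists_mk {y : Model.{u}} (h : y ≠ ⊥) (h' : y ≠ ⊤) : ∃ a, mk a = y := by
  induction y using WithBot.recBotCoe with
  | bot => exact absurd rfl h
  | coe y =>
    induction y using WithTop.recTopCoe with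
    | top => exact absurd rfl h'
    | coe a => exact ⟨a, rfl⟩

/-- The vertices. -/
def vertex (o : Fin 3) (j : Fin 19) : Face.{u} := ⟨o.castLE (by decide), j⟩

/-- The facets. -/
def facet (o : Fin 3) (j : Fin 19) : Face.{u} := ⟨o.natAdd 21, j⟩

theorem rot_vertex (o : Fin 3) (j k : Fin 19) : (vertex.{u} o j).rot k = vertex o (j + k) := rfl

theorem rot_facet (o : Fin 3) (j k : Fin 19) : (facet.{u} o j).rot k = facet o (j + k) := rfl

theorem exists_vertex (a : Face.{u}) : ∃ o j, vertex o j ≤ a := by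
  obtain ⟨o, j, h⟩ := Face.exists_vertex_le.{u} a.orbit
  refine ⟨o, j + a.pos, ?_⟩
  have := Face.rot_le_rot (j := a.pos) |>.2 h
  simpa [Face.rot, vertex, facet] using this

theorem exists_facet (a : Face.{u}) : ∃ o j, a ≤ facet o j := by
  obtain ⟨o, j, h⟩ := Face.exists_le_facet.{u} a.orbit
  refine ⟨o, j + a.pos, ?_⟩
  have := Face.rot_le_rot (j := a.pos) |>.2 h
  simpa [Face.rot, vertex, facet] using this

theorem isAtom_vertex (o : Fin 3) (j : Fin 19) : IsAtom (mk (vertex.{u} o j)) := by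
  refine ⟨mk_ne_bot _, fun y hy => by_contra fun h => ?_⟩
  obtain ⟨a, rfl⟩ := exists_mk h (hy.trans_le le_top).ne
  have := Face.orbitRank_lt (Face.lt_iff.1 (mk_lt_mk.1 hy))
  have h0 : ∀ o : Fin 3, orbitRank (o.castLE (by decide)) = 0 := by decide
  rw [vertex, h0] at this
  exact absurd this (Fin.not_lt_zero _)

theorem isCoatom_facet (o : Fin 3) (j : Fin 19) : IsCoatom (mk (facet.{u} o j)) := by
  refine ⟨mk_ne_top _, fun y hy => by_contra fun h => ?_⟩
  obtain ⟨a, rfl⟩ := exists_mk (bot_le.trans_lt hy).ne' h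
  have := Face.orbitRank_lt (Face.lt_iff.1 (mk_lt_mk.1 hy))
  have h0 : ∀ o : Fin 3, orbitRank (o.natAdd 21) = 3 := by decide
  rw [facet, h0] at this
  exact absurd this (Fin.le_last _).not_gt

theorem exists_mk_vertex {y : Model.{u}} (hy : y ≠ ⊥) : ∃ o j, mk (vertex o j) ≤ y := by
  by_cases h : y = ⊤
  · exact ⟨0, 0, h ▸ le_top⟩
  · obtain ⟨a, rfl⟩ := exists_mk hy h
    simpa only [mk_le_mk] using exists_vertex a

theorem exists_mk_facet {y : Model.{u}} (hy : y ≠ ⊤) : ∃ o j, y ≤ mk (facet o j) := by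
  by_cases h : y = ⊥
  · exact ⟨0, 0, h ▸ bot_le⟩
  · obtain ⟨a, rfl⟩ := exists_mk h hy
    simpa only [mk_le_mk] using exists_facet a

theorem exists_eq_vertex {y : Model.{u}} (hy : IsAtom y) : ∃ o j, mk (vertex o j) = y := by
  obtain ⟨o, j, h⟩ := exists_mk_vertex hy.1
  exact ⟨o, j, (hy.le_iff.1 h).resolve_left (mk_ne_bot _)⟩

theorem exists_eq_facet {y : Model.{u}} (hy : IsCoatom y) : ∃ o j, mk (facet o j) = y := by
  obtain ⟨o, j, h⟩ := exists_mk_facet hy.1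
  exact ⟨o, j, (hy.le_iff.1 h).resolve_left (mk_ne_top _)⟩

theorem exists_labelling_vertex (o : Fin 3) (j : Fin 19) :
    ∃ e, Labelling (mk (vertex.{u} o j)) e := by
  refine ⟨_, Labelling.of_ne_top (e := fun a => mk ((Face.upper o a).rot j)) 
    (fun a b ha hb => ?_) (fun _ => mk_ne_top _) ?_ fun y hy h => ?_⟩
  · rw [mk_le_mk, Face.rot_le_rot, Face.upper_le_upper o a b ha hb]
  · rw [Face.upper_zero, ← vertex, rot_vertex, zero_add]
  · obtain ⟨b, rfl⟩ := exists_mk (ne_bot_of_le_ne_bot (mk_ne_bot _) h) hy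
    rw [mk_le_mk, ← Face.rot_rot_neg j b, ← zero_add j, ← rot_vertex, zero_add,
      Face.rot_le_rot] at h
    obtain ⟨a, ha, h⟩ := Face.exists_upper_eq o _ _ h
    exact ⟨a, ha, by rw [h]; exact congrArg mk (Face.rot_rot_neg j b)⟩

theorem exists_labelling_facet (o : Fin 3) (j : Fin 19) :
    ∃ e, Labelling (toDual (mk (facet.{u} o j))) e := by
  refine ⟨_, Labelling.of_ne_top (e := fun a => toDual (mk ((Face.lower o a).rot j)))
    (fun a b ha hb => ?_) (fun _ => mk_ne_bot _) ?_ fun y hy h => ?_⟩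
  · rw [toDual_le_toDual, mk_le_mk, Face.rot_le_rot, Face.lower_le_lower o a b ha hb]
  · rw [Face.lower_zero, ← facet, rot_facet, zero_add]
  · obtain ⟨b, rfl⟩ := exists_mk (y := ofDual y) hy (ne_top_of_le_ne_top (mk_ne_top _) h)
    replace h : mk b ≤ mk (facet o j) := h
    rw [mk_le_mk, ← Face.rot_rot_neg j b, ← zero_add j, ← rot_facet, zero_add,
      Face.rot_le_rot] at h
    obtain ⟨a, ha, h⟩ := Face.exists_lower_eq o _ _ h
    exact ⟨a, ha, by rw [h]; exact congrArg mk (Face.rot_rot_neg j b)⟩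

theorem linked_vertex {o : Fin 3} {j : Fin 19} {f g : Flag Model.{u}}
    (hf : f.face 0 = mk (vertex o j)) (hg : g.face 0 = mk (vertex o j)) : f.Linked g :=
  have ⟨_, L⟩ := exists_labelling_vertex.{u} o j
  L.linked (isAtom_vertex o j) hf hg

theorem linked_facet {o : Fin 3} {j : Fin 19} {f g : Flag Model.{u}}
    (hf : f.face 3 = mk (facet o j)) (hg : g.face 3 = mk (facet o j)) : f.Linked g :=
  have ⟨_, L⟩ := exists_labelling_facet.{u} o j
  L.linked_dual (isCoatom_facet o j) hf hg

theorem exists_flag {o p : Fin 3} {j k : Fin 19} (h : vertex.{u} o j ≤ facet p k) :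
    ∃ f : Flag Model.{u}, f.face 0 = mk (vertex o j) ∧ f.face 3 = mk (facet p k) :=
  have ⟨_, L⟩ := exists_labelling_vertex.{u} o j
  L.exists_flag (isAtom_vertex o j) (isCoatom_facet p k) (mk_le_mk.2 h)

theorem vertex_le_facet : ∀ (p : Fin 3) (j : Fin 19), vertex.{u} 0 j ≤ facet p j := by
  decide +kernel

theorem vertex_le_facet_succ : ∀ j : Fin 19, vertex.{u} 0 j ≤ facet 0 (j + 1) := by
  decide +kernel

theorem linked_of_vertex_zero (j : Fin 19) {f g : Flag Model.{u}}
    (hf : f.face 0 = mk (vertex 0 j)) (hg : g.face 0 = mk (vertex 0 0)) : f.Linked g := by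
  have key (n : ℕ) : ∀ {f : Flag Model.{u}}, f.face 0 = mk (vertex 0 (Fin.ofNat 19 n)) →
      f.Linked g := by
    induction n with
    | zero => exact fun hf => linked_vertex hf hg
    | succ n ih =>
      intro f hf
      have e : Fin.ofNat 19 (n + 1) = Fin.ofNat 19 n + 1 := by
        ext; simp [Fin.val_add]
      rw [e] at hf
      obtain ⟨p, hp0, hp3⟩ := exists_flag (vertex_le_facet_succ.{u} (Fin.ofNat 19 n))
      obtain ⟨q, hq0, hq3⟩ := exists_flag (vertex_le_facet.{u} 0 (Fin.ofNat 19 n + 1))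
      exact (linked_vertex hf hq0).trans ((linked_facet hq3 hp3).trans (ih hp0))
  refine key j ?_
  rw [hf, Fin.ofNat_val_eq_self]

theorem exists_face_three (f : Flag Model.{u}) : ∃ o j, f.face 3 = mk (facet o j) := by
  have h (i : Fin 4) : ∃ a, mk a = f.face i :=
    exists_mk (f.bot_lt_face i).ne' (f.face_lt_top i).ne
  choose a ha using h
  have hlt {i j : Fin 4} (h : i < j) : orbitRank (a i).orbit < orbitRank (a j).orbit :=
    Face.orbitRank_lt (Face.lt_iff.1 (mk_lt_mk.1 (by rw [ha, ha]; exact f.strictMono h)))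
  have h01 := hlt (i := 0) (j := 1) (by decide)
  have h12 := hlt (i := 1) (j := 2) (by decide)
  have h23 := hlt (i := 2) (j := 3) (by decide)
  have h3 : orbitRank (a 3).orbit = 3 := by omega
  have : ∀ p, orbitRank p = 3 → ∃ o : Fin 3, p = o.natAdd 21 := by decide
  obtain ⟨o, ho⟩ := this _ h3
  exact ⟨o, (a 3).pos, by rw [← ha, facet, ← ho]⟩

theorem isCell57 : IsCell57 Model.{u} where
  bot_ne_top := nofun
  atomic y hy := by
    obtain ⟨o, j, h⟩ := exists_mk_vertex hy
    exact ⟨_, isAtom_vertex o j, h⟩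
  coatomic y hy := by
    obtain ⟨o, j, h⟩ := exists_mk_facet hy
    exact ⟨_, isCoatom_facet o j, h⟩
  up x hx := by
    obtain ⟨o, j, rfl⟩ := exists_eq_vertex hx
    exact exists_labelling_vertex o j
  down x hx := by
    obtain ⟨o, j, rfl⟩ := exists_eq_facet hx
    exact exists_labelling_facet o j
  conn f g := by
    obtain ⟨q, hq, -⟩ := exists_flag (vertex_le_facet.{u} 0 0)
    have key (f : Flag Model.{u}) : f.Linked q := by
      obtain ⟨o, j, h⟩ := exists_face_three f
      obtain ⟨p, hp0, hp3⟩ := exists_flag (vertex_le_facet.{u} o j)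
      exact (linked_facet h hp3).trans (linked_of_vertex_zero j hp0 hq)
    exact (key f).trans (key g).symm

instance : Finite Model.{u} :=
  have : Finite Face.{u} := Finite.of_injective (fun a => (a.orbit, a.pos)) fun _ _ h =>
    Face.ext (congrArg Prod.fst h) (congrArg Prod.snd h)
  inferInstanceAs (Finite (Option (Option Face.{u})))

theorem le_card_flag : 3420 ≤ Nat.card (Flag Model.{u}) := by
  rw [isCell57.card_flag]
  have : Nat.card (Fin 3 × Fin 19) ≤ Nat.card {x : Model.{u} // IsAtom x} := by
    refine Nat.card_le_card_of_injective
      (fun p : Fin 3 × Fin 19 => ⟨mk (vertex p.1 p.2), isAtom_vertex p.1 p.2⟩) fun p q h => ?_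
    have := mk_injective (congrArg Subtype.val h)
    simp only [vertex, Face.mk.injEq, Fin.castLE_inj] at this
    exact Prod.ext this.1 this.2
  rw [Nat.card_prod, Nat.card_fin, Nat.card_fin] at this
  omega

/-- Whether the faces are those of a flag. -/
def isFlag (s : Fin 4 → Face.{u}) : Bool := s 0 < s 1 && s 1 < s 2 && s 2 < s 3

/-- Whether exchanging one face at a time leads from the flag `s` to the flag `t`. -/
def walks : List (Fin 4 × ℕ) → (Fin 4 → Face.{u}) → (Fin 4 → Face.{u}) → Bool
  | [], s, t => decide (∀ i, s i = t i)
  | (i, c) :: w, s, t => s i ≠ Face.ofCode c && isFlag (Function.update s i (Face.ofCode c)) &&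
      walks w (Function.update s i (Face.ofCode c)) t

theorem exists_flag_of_isFlag {s : Fin 4 → Face.{u}} (h : isFlag s) :
    ∃ f : Flag Model.{u}, ∀ i, f.face i = mk (s i) := by
  simp only [isFlag, Bool.and_eq_true, decide_eq_true_eq] at h
  refine ⟨Flag.of (mk (s 0)) (mk (s 1)) (mk (s 2)) (mk (s 3)) ⟨(mk_ne_bot _).bot_lt,
    mk_lt_mk.2 h.1.1, mk_lt_mk.2 h.1.2, mk_lt_mk.2 h.2, (mk_ne_top _).lt_top⟩, fun i => ?_⟩
  fin_cases i <;> rfl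

theorem run_face_of_walks (C : IsCell57 Model.{u}) {w : List (Fin 4 × ℕ)} {s t : Fin 4 → Face.{u}}
    (h : walks w s t) {f : Flag Model.{u}} (hf : ∀ i, f.face i = mk (s i)) (i : Fin 4) :
    (run C.nbr (w.map Prod.fst) f).face i = mk (t i) := by
  induction w generalizing s f with
  | nil =>
    simp only [walks, decide_eq_true_eq] at h
    rw [← h i]
    exact hf i
  | cons p w ih =>
    obtain ⟨k, c⟩ := p
    simp only [walks, Bool.and_eq_true, decide_eq_true_eq] at h
    obtain ⟨g, hg⟩ := exists_flag_of_isFlag h.1.2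
    have : C.nbr k f = g := C.adj_iff.1 fun j => by
      rw [hf, hg, mk_injective.eq_iff]
      rcases eq_or_ne j k with rfl | hj
      · simp [h.1.1]
      · simp [hj]
    rw [List.map_cons, run_cons, this]
    exact ih h.2 hg

end Model

theorem grpFacts : GrpFacts := by
  let s : Fin 4 → Face.{0} := fun i => Face.ofCode ([0, 57, 228, 399].getD i 0)
  let t : Fin 4 → Face.{0} := fun i => Face.ofCode ([37, 121, 365, 422].getD i 0)
  obtain ⟨f, hf⟩ := Model.exists_flag_of_isFlag (s := s) (by decide +kernel)
  have hs : Model.walks ((List.replicate 9 [0, 1, 2, 3]).flatten.zip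
      [19, 95, 285, 425, 18, 75, 387, 455, 37, 121, 365, 422, 45, 155, 301, 415, 3, 137, 282, 449,
        34, 225, 381, 419, 39, 115, 229, 400, 31, 134, 324, 418, 0, 57, 228, 399]) s s := by
    decide +kernel
  have ht : Model.walks ((List.replicate 3 [0, 1, 2, 3]).flatten.zip
      [19, 95, 285, 425, 18, 75, 387, 455, 37, 121, 365, 422]) s t := by
    decide +kernel
  have ht' : Model.walks (([1, 2, 1, 0, 3] ++ ([1, 2] ++ [1, 2, 1, 0, 3].reverse) : List (Fin 4)).zip
      [76, 266, 152, 42, 452, 209, 384, 422, 37, 189, 365, 121]) s t := by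
    decide +kernel
  have C := Model.isCell57.{0}
  refine C.grpFacts Model.le_card_flag f (Flag.ext (funext fun i => ?_))
    (Flag.ext (funext fun i => ?_))
  · rw [hf]
    exact Model.run_face_of_walks C hs hf i
  · exact (Model.run_face_of_walks C ht hf i).trans (Model.run_face_of_walks C ht' hf i).symm

end Model

end Cell57

namespace Cell57

open OrderDual Set

/-! ### Labellings and hemi-icosahedra -/

section Hemi

/-- The faces of the hemi-icosahedron below `b`. -/
def below (b : Fin 33) : Finset (Fin 33) := {a | hle a b}

theorem below_mem : ∀ b, below b ∈ HemiIcosaPosetData := by decide +kernel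

theorem exists_below_eq : ∀ S ∈ HemiIcosaPosetData, ∃ b, below b = S := by
  have h : HemiIcosaPosetData ⊆ Finset.univ.image below := by decide +kernel
  simpa using fun S hS => Finset.mem_image.1 (h hS)

theorem below_subset_below {a b : Fin 33} : below a ⊆ below b ↔ hle a b := by
  refine ⟨fun h => ?_, fun h c hc => ?_⟩
  · simpa [below] using h (by simpa [below] using hle_refl a : a ∈ below a)
  · simp only [below, Finset.mem_filter, Finset.mem_univ, true_and] at hc ⊢
    exact hle_trans _ _ hc _ h

/-- The face `b` of the hemi-icosahedron. -/
def hemi (b : Fin 33) : HemiIcosaPoset := ⟨below b, below_mem b⟩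

theorem hemi_le_hemi {a b : Fin 33} : hemi a ≤ hemi b ↔ hle a b := below_subset_below

theorem bijective_hemi : Function.Bijective hemi :=
  ⟨fun a b h => hle_antisymm a b (hemi_le_hemi.1 h.le) (hemi_le_hemi.1 h.ge),
    fun S => (exists_below_eq S.1 S.2).imp fun _ h => Subtype.ext h⟩

variable {α : Type*} [PartialOrder α]

theorem exists_labelling_of_orderIso {x : α} (φ : Ici x ≃o HemiIcosaPoset) :
    ∃ e, Labelling x e := by
  refine ⟨fun a => φ.symm (hemi a), fun a b => ?_, fun y => ⟨fun h => ?_, ?_⟩⟩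
  · rw [Subtype.coe_le_coe, φ.symm.le_iff_le, hemi_le_hemi]
  · obtain ⟨a, ha⟩ := bijective_hemi.2 (φ ⟨y, h⟩)
    exact ⟨a, by rw [ha, φ.symm_apply_apply]⟩
  · rintro ⟨a, rfl⟩
    exact (φ.symm (hemi a)).2

theorem Labelling.nonempty_orderIso {x : α} {e : Fin 33 → α} (L : Labelling x e) :
    Nonempty (Ici x ≃o HemiIcosaPoset) := by
  let g (a : Fin 33) : Ici x := ⟨e a, (L.range _).2 ⟨a, rfl⟩⟩
  have hg : Function.Bijective g := ⟨fun a b h => L.injective (congrArg Subtype.val h),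
    fun y => ((L.range y).1 y.2).imp fun _ h => Subtype.ext h⟩
  let E := (Equiv.ofBijective g hg).symm.trans (Equiv.ofBijective hemi bijective_hemi)
  refine ⟨⟨E, fun {y z} => ?_⟩⟩
  obtain ⟨a, rfl⟩ := hg.2 y
  obtain ⟨b, rfl⟩ := hg.2 z
  have h (a : Fin 33) : E (g a) = hemi a := by
    change hemi ((Equiv.ofBijective g hg).symm (Equiv.ofBijective g hg a)) = _
    rw [Equiv.symm_apply_apply]
  rw [h, h, hemi_le_hemi, ← L.le_iff]
  rfl

theorem exists_labelling_dual_of_orderIso {x : α} (φ : Iic x ≃o HemiDodecaPoset) :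
    ∃ e, Labelling (toDual x) e :=
  exists_labelling_of_orderIso (x := toDual x)
    { toFun y := ofDual (φ ⟨ofDual y.1, y.2⟩)
      invFun S := ⟨toDual (φ.symm (toDual S)).1, (φ.symm (toDual S)).2⟩
      left_inv _ := Subtype.ext (congrArg Subtype.val (φ.symm_apply_apply _))
      right_inv S := φ.apply_symm_apply (toDual S)
      map_rel_iff' {y z} := φ.le_iff_le (x := ⟨ofDual z.1, z.2⟩) (y := ⟨ofDual y.1, y.2⟩) }

theorem Labelling.nonempty_orderIso_dual {x : α} {e : Fin 33 → αᵒᵈ} (L : Labelling (toDual x) e) :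
    Nonempty (Iic x ≃o HemiDodecaPoset) := by
  obtain ⟨φ⟩ := L.nonempty_orderIso
  exact ⟨{
    toFun y := toDual (φ ⟨toDual y.1, y.2⟩)
    invFun S := ⟨ofDual (φ.symm (ofDual S)).1, (φ.symm (ofDual S)).2⟩
    left_inv y := Subtype.ext (congrArg Subtype.val (φ.symm_apply_apply _))
    right_inv S := φ.apply_symm_apply (ofDual S)
    map_rel_iff' {y z} := φ.le_iff_le (x := ⟨toDual z.1, z.2⟩) (y := ⟨toDual y.1, y.2⟩) }⟩

end Hemi

/-! ### Flags and maximal chains -/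

section Rank

variable {α : Type*} [PartialOrder α] [BoundedOrder α]

/-- All faces of a flag, including the improper ones. -/
def Flag.chain (f : Flag α) : Set α := {y | y = ⊥ ∨ y = ⊤ ∨ ∃ i, f.face i = y}

theorem Flag.face_mem_chain (f : Flag α) (i : Fin 4) : f.face i ∈ f.chain := .inr (.inr ⟨i, rfl⟩)

theorem Flag.isChain_chain (f : Flag α) : IsChain (· ≤ ·) f.chain := by
  rintro y (rfl | rfl | ⟨i, rfl⟩) z (rfl | rfl | ⟨j, rfl⟩) -
  all_goals try simp only [bot_le, le_top, true_or, or_true]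
  exact (le_total i j).imp (f.strictMono.monotone ·) (f.strictMono.monotone ·)

/-- A rank function for which every maximal chain has exactly one face of each rank. -/
structure IsRank (r : α → ℤ) : Prop where
  strictMono : StrictMono r
  bot : r ⊥ = -1
  top : r ⊤ = 4
  flag_ranks : ∀ c : Set α, IsMaxChain (· ≤ ·) c → ∀ i ∈ Icc (-1 : ℤ) 4, ∃! F, F ∈ c ∧ r F = i

theorem rank_face {r : α → ℤ} (hr : StrictMono r) (hb : r ⊥ = -1) (ht : r ⊤ = 4) (f : Flag α)
    (i : Fin 4) : r (f.face i) = i := by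
  obtain ⟨h0, h1, h2, h3, h4⟩ := f.lt_succ
  have := hr h0
  have := hr h1
  have := hr h2
  have := hr h3
  have := hr h4
  fin_cases i <;> simp <;> omega

namespace IsRank

variable {r : α → ℤ}

theorem dual (R : IsRank r) : IsRank fun y : αᵒᵈ => 3 - r (ofDual y) where
  strictMono y z h := by
    have := R.strictMono (ofDual_lt_ofDual.2 h)
    dsimp only
    omega
  bot := by simp [R.top]
  top := by simp [R.bot]
  flag_ranks c hc i hi := by
    obtain ⟨F, ⟨hF, h⟩, hu⟩ := R.flag_ranks (toDual ⁻¹' c) hc.symm (3 - i)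
      ⟨by linarith [hi.2], by linarith [hi.1]⟩
    refine ⟨toDual F, ⟨hF, by simp [h]⟩, fun G hG => ?_⟩
    exact congrArg toDual (hu (ofDual G) ⟨hG.1, by linarith [hG.2]⟩)

theorem mem_Icc (R : IsRank r) (y : α) : r y ∈ Icc (-1 : ℤ) 4 :=
  ⟨R.bot ▸ R.strictMono.monotone bot_le, R.top ▸ R.strictMono.monotone le_top⟩

theorem face (R : IsRank r) (f : Flag α) (i : Fin 4) : r (f.face i) = i :=
  rank_face R.strictMono R.bot R.top f i

theorem le_of_mem (R : IsRank r) {c : Set α} (hc : IsChain (· ≤ ·) c) {y z : α} (hy : y ∈ c) (hz : z ∈ c)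
    (h : r y ≤ r z) : y ≤ z := by
  rcases hc.total hy hz with h' | h'
  · exact h'
  · obtain rfl | h' := h'.eq_or_lt
    · exact le_rfl
    · exact absurd (R.strictMono h') h.not_gt

theorem eq_of_mem (R : IsRank r) {c : Set α} (hc : IsChain (· ≤ ·) c) {y z : α} (hy : y ∈ c) (hz : z ∈ c)
    (h : r y = r z) : y = z :=
  le_antisymm (R.le_of_mem hc hy hz h.le) (R.le_of_mem hc hz hy h.ge)

theorem lt_of_mem (R : IsRank r) {c : Set α} (hc : IsChain (· ≤ ·) c) {y z : α} (hy : y ∈ c) (hz : z ∈ c)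
    (h : r y < r z) : y < z :=
  (R.le_of_mem hc hy hz h.le).lt_of_ne fun e => h.ne (e ▸ rfl)

theorem exists_mem_chain (R : IsRank r) (f : Flag α) {i : ℤ} (hi : i ∈ Icc (-1 : ℤ) 4) :
    ∃ y ∈ f.chain, r y = i := by
  obtain rfl | h := eq_or_ne i (-1)
  · exact ⟨⊥, .inl rfl, R.bot⟩
  obtain rfl | h' := eq_or_ne i 4
  · exact ⟨⊤, .inr (.inl rfl), R.top⟩
  obtain ⟨h1, h2⟩ := hi
  refine ⟨f.face ⟨i.toNat, by omega⟩, f.face_mem_chain _, ?_⟩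
  rw [R.face]
  simp
  omega

theorem isMaxChain_chain (R : IsRank r) (f : Flag α) : IsMaxChain (· ≤ ·) f.chain := by
  refine ⟨f.isChain_chain, fun t ht h => h.antisymm fun y hy => ?_⟩
  obtain ⟨z, hz, hzy⟩ := R.exists_mem_chain f (R.mem_Icc y)
  rwa [← R.eq_of_mem ht (h hz) hy hzy]

theorem exists_chain_eq (R : IsRank r) {c : Set α} (hc : IsMaxChain (· ≤ ·) c) : ∃ f : Flag α, f.chain = c := by
  have h (i : Fin 4) := (R.flag_ranks c hc i ⟨by omega, by omega⟩).exists
  choose a ha hi using h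
  have hlt {y z : α} (hy : y ∈ c) (hz : z ∈ c) (h : r y < r z) : y < z :=
    R.lt_of_mem hc.isChain hy hz h
  let f : Flag α := ⟨a, fun i j h => hlt (ha i) (ha j) (by rw [hi, hi]; simpa using h),
    hlt hc.bot_mem (ha 0) (by rw [hi, R.bot]; simp), hlt (ha 3) hc.top_mem (by rw [hi, R.top]; simp)⟩
  refine ⟨f, (R.isMaxChain_chain f).2 hc.isChain ?_⟩
  rintro y (rfl | rfl | ⟨i, rfl⟩)
  exacts [hc.bot_mem, hc.top_mem, ha i]

theorem exists_subset_chain (R : IsRank r) {c : Set α} (hc : IsChain (· ≤ ·) c) : ∃ f : Flag α, c ⊆ f.chain := by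
  obtain ⟨M, hM, h⟩ := hc.exists_maxChain
  obtain ⟨f, rfl⟩ := R.exists_chain_eq hM
  exact ⟨f, h⟩

theorem face_mem_chain_iff (R : IsRank r) {f g : Flag α} {i : Fin 4} : f.face i ∈ g.chain ↔ f.face i = g.face i :=
  ⟨fun h => R.eq_of_mem g.isChain_chain h (g.face_mem_chain i) (by rw [R.face, R.face]),
    fun h => h ▸ g.face_mem_chain i⟩

theorem chain_diff_eq (R : IsRank r) {f g : Flag α} {i : Fin 4} (h : f.Adj i g) :
    f.chain \ g.chain = {f.face i} := by
  ext y
  rw [mem_sdiff, mem_singleton_iff]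
  constructor
  · rintro ⟨rfl | rfl | ⟨j, rfl⟩, hy⟩
    · exact absurd (.inl rfl) hy
    · exact absurd (.inr (.inl rfl)) hy
    · rw [R.face_mem_chain_iff, h j, not_not] at hy
      rw [hy]
  · rintro rfl
    refine ⟨f.face_mem_chain i, ?_⟩
    rw [R.face_mem_chain_iff, h i]
    exact fun h => h rfl

theorem exists_adj_of_chain_diff_eq (R : IsRank r) {f g : Flag α} {F : α} (h : f.chain \ g.chain = {F}) :
    ∃ i, f.Adj i g := by
  have hF : F ∈ f.chain \ g.chain := h ▸ mem_singleton F
  obtain ⟨rfl | rfl | ⟨i, rfl⟩, hF⟩ := hF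
  · exact absurd (.inl rfl) hF
  · exact absurd (.inr (.inl rfl)) hF
  refine ⟨i, fun j => ?_⟩
  have := congrArg (f.face j ∈ ·) h
  simp only [mem_sdiff, mem_singleton_iff, f.face_mem_chain, true_and, f.strictMono.injective.eq_iff,
    R.face_mem_chain_iff, eq_iff_iff] at this
  rw [ne_eq, ← this, not_not]

theorem isAtom_iff (R : IsRank r) {y : α} : IsAtom y ↔ r y = 0 := by
  constructor
  · intro hy
    obtain ⟨f, hf⟩ := R.exists_subset_chain (IsChain.singleton (r := (· ≤ ·)) (a := y))
    have h0 : r ⊥ < r y := R.strictMono hy.bot_lt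
    have h := R.le_of_mem f.isChain_chain (f.face_mem_chain 0) (hf rfl) (by
      rw [R.face, Fin.val_zero]
      rw [R.bot] at h0
      simp
      omega)
    rw [← (hy.le_iff.1 h).resolve_left f.bot_lt.ne', R.face]
    rfl
  · intro hy
    refine ⟨?_, fun z hz => by_contra fun h => ?_⟩
    · rintro rfl
      simp [R.bot] at hy
    · have h1 := R.strictMono hz
      have h2 := R.strictMono (bot_lt_iff_ne_bot.2 h)
      rw [R.bot] at h2
      omega

theorem isCoatom_iff (R : IsRank r) {y : α} : IsCoatom y ↔ r y = 3 := by
  rw [← isAtom_dual_iff_isCoatom, R.dual.isAtom_iff, ofDual_toDual, sub_eq_zero, eq_comm]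

theorem atomic (R : IsRank r) {y : α} (hy : y ≠ ⊥) : ∃ x, IsAtom x ∧ x ≤ y := by
  obtain ⟨f, hf⟩ := R.exists_subset_chain (IsChain.singleton (r := (· ≤ ·)) (a := y))
  refine ⟨f.face 0, R.isAtom_iff.2 (R.face f 0), ?_⟩
  obtain rfl | rfl | ⟨i, rfl⟩ := hf rfl
  exacts [absurd rfl hy, le_top, f.strictMono.monotone (Fin.zero_le i)]

end IsRank

/-- A maximal chain of a graded poset of rank 4 meets every rank. -/
theorem isRank_of_exists_between [Finite α] {r : α → ℤ} (hr : StrictMono r) (hb : r ⊥ = -1)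
    (ht : r ⊤ = 4) (h : ∀ y z, y < z → r y + 1 < r z → ∃ x, y < x ∧ x < z) : IsRank r where
  strictMono := hr
  bot := hb
  top := ht
  flag_ranks c hc i hi := by
    have hle {y z : α} (hy : y ∈ c) (hz : z ∈ c) (h : r y ≤ r z) : y ≤ z := by
      rcases hc.isChain.total hy hz with h' | h'
      · exact h'
      · obtain rfl | h' := h'.eq_or_lt
        exacts [le_rfl, absurd (hr h') h.not_gt]
    refine existsUnique_of_exists_of_unique ?_ fun y z hy hz =>
      le_antisymm (hle hy.1 hz.1 (hy.2.trans hz.2.symm).le) (hle hz.1 hy.1 (hz.2.trans hy.2.symm).le)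
    by_contra! hne
    obtain ⟨y, ⟨hyc, hyi⟩, hy⟩ := Set.exists_max_image {y ∈ c | r y ≤ i} r (toFinite _)
      ⟨⊥, hc.bot_mem, hb ▸ hi.1⟩
    obtain ⟨z, ⟨hzc, hzi⟩, hz⟩ := Set.exists_min_image {y ∈ c | i < r y} r (toFinite _)
      ⟨⊤, hc.top_mem, lt_of_le_of_ne (ht ▸ hi.2) (hne ⊤ hc.top_mem).symm⟩
    have hyi' := lt_of_le_of_ne hyi (hne y hyc)
    obtain ⟨x, hyx, hxz⟩ := h y z ((hle hyc hzc (hyi.trans hzi.le)).lt_of_ne fun e => by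
      rw [e] at hyi; omega) (by omega)
    have hx (w) (hw : w ∈ c) : w ≤ y ∨ z ≤ w := by
      rcases le_or_gt (r w) i with h | h
      · exact .inl (hle hw hyc (hy w ⟨hw, h⟩))
      · exact .inr (hle hzc hw (hz w ⟨hw, h⟩))
    have hxc : x ∈ c := by
      rw [hc.2 (hc.isChain.insert fun w hw _ => ?_) (subset_insert x c)]
      · exact mem_insert x c
      · exact (hx w hw).symm.imp hxz.le.trans fun h => h.trans hyx.le
    rcases hx x hxc with h | h
    exacts [h.not_gt hyx, h.not_gt hxz]

end Rank

end Cell57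

namespace Cell57

open Set

section Polytope

variable {α : Type*} [PartialOrder α] [BoundedOrder α]

/-- A graded poset with the right facets and vertex figures, connected by maximal chains. -/
theorem IsRank.isCell57 {r : α → ℤ} (R : IsRank r)
    (up : ∀ x, r x = 0 → Nonempty (Ici x ≃o HemiIcosaPoset))
    (down : ∀ x, r x = 3 → Nonempty (Iic x ≃o HemiDodecaPoset))
    (conn : ∀ c d : Set α, IsMaxChain (· ≤ ·) c → IsMaxChain (· ≤ ·) d →
      Relation.ReflTransGen (fun x y => IsMaxChain (· ≤ ·) y ∧ ∃ F, x \ y = {F}) c d) :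
    IsCell57 α where
  bot_ne_top h := by
    have := R.bot
    rw [h, R.top] at this
    omega
  atomic _ hy := R.atomic hy
  coatomic y hy := by
    obtain ⟨x, hx, h⟩ := R.dual.atomic (y := OrderDual.toDual y) hy
    exact ⟨OrderDual.ofDual x, hx.dual, h⟩
  up x hx := exists_labelling_of_orderIso (up x (R.isAtom_iff.1 hx)).some
  down x hx := exists_labelling_dual_of_orderIso (down x (R.isCoatom_iff.1 hx)).some
  conn f g := by
    have key {c : Set α} (h : Relation.ReflTransGen
        (fun x y => IsMaxChain (· ≤ ·) y ∧ ∃ F, x \ y = {F}) f.chain c) :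
        ∃ p : Flag α, p.chain = c ∧ f.Linked p := by
      induction h with
      | refl => exact ⟨f, rfl, .refl⟩
      | tail _ h ih =>
        obtain ⟨p, rfl, hp⟩ := ih
        obtain ⟨q, rfl⟩ := R.exists_chain_eq h.1
        exact ⟨q, rfl, hp.tail (R.exists_adj_of_chain_diff_eq h.2.choose_spec)⟩
    obtain ⟨p, hp, h⟩ := key (conn _ _ (R.isMaxChain_chain f) (R.isMaxChain_chain g))
    rwa [show p = g from Flag.ext (funext fun i => R.face_mem_chain_iff.1
      (hp ▸ p.face_mem_chain i))] at h

theorem IsRank.of_isCell57 (C : IsCell57 α) [Finite α] {r : α → ℤ} (hr : StrictMono r)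
    (hb : r ⊥ = -1) (ht : r ⊤ = 4) : IsRank r := by
  refine isRank_of_exists_between hr hb ht fun y z hyz h => ?_
  have hf := rank_face hr hb ht
  rcases eq_or_ne y ⊥ with rfl | hy
  · rcases eq_or_ne z ⊤ with rfl | hz
    · obtain ⟨f⟩ := C.nonempty_flag
      exact ⟨_, f.bot_lt_face 0, f.face_lt_top 0⟩
    · obtain ⟨f, i, rfl⟩ := C.exists_flag hyz.ne' hz
      rw [hb, hf] at h
      exact ⟨f.face 0, f.bot_lt, f.strictMono (by omega)⟩
  · rcases eq_or_ne z ⊤ with rfl | hz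
    · obtain ⟨f, i, rfl⟩ := C.exists_flag hy hyz.ne
      rw [ht, hf] at h
      exact ⟨f.face 3, f.strictMono (by omega), f.lt_top⟩
    · obtain ⟨f, i, j, -, rfl, rfl⟩ := C.exists_flag_of_le hy hz hyz.le
      rw [hf, hf] at h
      refine ⟨f.face ⟨i + 1, by omega⟩, f.strictMono ?_, f.strictMono ?_⟩ <;>
        simp only [Fin.lt_def] <;> omega

theorem IsCell57.diamond (C : IsCell57 α) {r : α → ℤ} (R : IsRank r) {F G : α} (hFG : F < G)
    (h : r G = r F + 2) :
    ∃ H₁ H₂ : α, H₁ ≠ H₂ ∧ ∀ H : α, (F < H ∧ H < G) ↔ (H = H₁ ∨ H = H₂) := by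
  obtain ⟨f, hf⟩ := R.exists_subset_chain (IsChain.pair (r := (· ≤ ·)) hFG.le)
  have hF : F ∈ f.chain := hf (.inl rfl)
  have hG : G ∈ f.chain := hf (.inr rfl)
  have hFi := R.mem_Icc F
  have hGi := R.mem_Icc G
  obtain ⟨i, hi⟩ : ∃ i : Fin 4, r F + 1 = i :=
    ⟨⟨(r F + 1).toNat, by have := hGi.2; omega⟩, by have := hFi.1; simp; omega⟩
  have hadj := C.adj_nbr i f
  have hmem {y : α} (hy : y ∈ f.chain) (hyi : r y ≠ i) : y ∈ (C.nbr i f).chain := by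
    obtain rfl | rfl | ⟨j, rfl⟩ := hy
    · exact .inl rfl
    · exact .inr (.inl rfl)
    · rw [R.face] at hyi
      rw [R.face_mem_chain_iff, hadj j]
      rintro rfl
      exact hyi rfl
  have hbetween {g : Flag α} (hF : F ∈ g.chain) (hG : G ∈ g.chain) : F < g.face i ∧ g.face i < G :=
    ⟨R.lt_of_mem g.isChain_chain hF (g.face_mem_chain i) (by rw [R.face]; omega),
      R.lt_of_mem g.isChain_chain (g.face_mem_chain i) hG (by rw [R.face]; omega)⟩
  refine ⟨f.face i, (C.nbr i f).face i, fun e => (hadj i).1 e rfl, fun H => ⟨fun hH => ?_, ?_⟩⟩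
  · have hlow {j : Fin 4} (hj : j < i) : f.face j < H :=
      (R.le_of_mem f.isChain_chain (f.face_mem_chain j) hF (by rw [R.face]; omega)).trans_lt hH.1
    have hhigh {j : Fin 4} (hj : i < j) : H < f.face j :=
      hH.2.trans_le (R.le_of_mem f.isChain_chain hG (f.face_mem_chain j) (by rw [R.face]; omega))
    let g : Flag α :=
      { face := Function.update f.face i H
        strictMono := fun j k hjk => by
          rcases eq_or_ne j i with rfl | hj
          · simpa [hjk.ne'] using hhigh hjk
          · rcases eq_or_ne k i with rfl | hk
            · simpa [hj] using hlow hjk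
            · simpa [hj, hk] using f.strictMono hjk
        bot_lt := by
          rcases eq_or_ne 0 i with rfl | hi
          · simpa using bot_le.trans_lt hH.1
          · simpa [hi] using f.bot_lt
        lt_top := by
          rcases eq_or_ne 3 i with rfl | hi
          · simpa using hH.2.trans_le le_top
          · simpa [hi] using f.lt_top }
    have hgi : g.face i = H := Function.update_self ..
    by_cases hfH : f.face i = H
    · exact .inl hfH.symm
    · right
      have hg : f.Adj i g := fun j => by
        rcases eq_or_ne j i with rfl | hj
        · simp [hgi, hfH]
        · simp [g, hj]
      rw [C.adj_iff.1 hg, hgi]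
  · rintro (rfl | rfl)
    · exact hbetween hF hG
    · exact hbetween (hmem hF (by omega)) (hmem hG (by omega))

theorem IsCell57.connected (C : IsCell57 α) {r : α → ℤ} (R : IsRank r) {c d : Set α}
    (hc : IsMaxChain (· ≤ ·) c) (hd : IsMaxChain (· ≤ ·) d) :
    Relation.ReflTransGen
      (fun x y : Set α => IsMaxChain (· ≤ ·) y ∧ c ∩ d ⊆ y ∧
        (∃ F G : α, x \ y = {F} ∧ y \ x = {G})) c d := by
  obtain ⟨f, rfl⟩ := R.exists_chain_eq hc
  obtain ⟨g, rfl⟩ := R.exists_chain_eq hd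
  obtain ⟨w, hw, hfg⟩ := C.exists_path f g
  have key (w : List (Fin 4)) (hw : ∀ i ∈ w, f.face i ≠ g.face i) : Relation.ReflTransGen
      (fun x y : Set α => IsMaxChain (· ≤ ·) y ∧ f.chain ∩ g.chain ⊆ y ∧
        (∃ F G : α, x \ y = {F} ∧ y \ x = {G})) f.chain (run C.nbr w f).chain := by
    induction w using List.reverseRecOn with
    | nil => exact .refl
    | append_singleton w i ih =>
      have hadj := C.adj_nbr i (run C.nbr w f)
      have hrun : run C.nbr (w ++ [i]) f = C.nbr i (run C.nbr w f) := by
        rw [run_append, run_cons, run_nil]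
      rw [← hrun] at hadj
      refine (ih fun j hj => hw j (by simp [hj])).tail ⟨R.isMaxChain_chain _, ?_, _, _,
        R.chain_diff_eq hadj, R.chain_diff_eq hadj.symm⟩
      rintro y ⟨rfl | rfl | ⟨j, rfl⟩, hy⟩
      · exact .inl rfl
      · exact .inr (.inl rfl)
      · rw [R.face_mem_chain_iff] at hy ⊢
        exact (C.run_face (fun h => hw j h hy) f).symm
  exact hfg ▸ key w hw

end Polytope

/-- The rank of a face of the model. -/
def Model.rank : Model.{u} → ℤ
  | none => -1
  | some none => 4
  | some (some a) => (orbitRank a.orbit : ℕ)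

theorem Model.strictMono_rank : StrictMono Model.rank.{u} := fun y z h => by
  have hb (a : Face.{u}) : (-1 : ℤ) < rank (mk a) := by
    change (-1 : ℤ) < ((orbitRank a.orbit : ℕ) : ℤ)
    omega
  have ht (a : Face.{u}) : rank (mk a) < 4 := by
    change ((orbitRank a.orbit : ℕ) : ℤ) < 4
    omega
  by_cases hz : z = ⊤
  · subst hz
    by_cases hy : y = ⊥
    · subst hy
      exact show (-1 : ℤ) < 4 by norm_num
    · obtain ⟨a, rfl⟩ := exists_mk hy h.ne
      exact ht a
  · obtain ⟨b, rfl⟩ := exists_mk (bot_le.trans_lt h).ne' hz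
    by_cases hy : y = ⊥
    · subst hy
      exact hb b
    · obtain ⟨a, rfl⟩ := exists_mk hy (h.trans_le le_top).ne
      have := Face.orbitRank_lt (Face.lt_iff.1 (mk_lt_mk.1 h))
      change ((orbitRank a.orbit : ℕ) : ℤ) < (orbitRank b.orbit : ℕ)
      omega

theorem Model.isRank : IsRank Model.rank.{u} :=
  .of_isCell57 isCell57 strictMono_rank rfl rfl

/-- The 57-cell. -/
noncomputable def polytope : APolytope.{u} 4 where
  α := Model.{u}
  rank := Model.rank
  rank_bot := Model.isRank.bot
  rank_top := Model.isRank.top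
  rank_strictMono := Model.strictMono_rank
  rank_mem := Model.isRank.mem_Icc
  flag_ranks := Model.isRank.flag_ranks
  diamond _ _ := Model.isCell57.diamond Model.isRank
  connected _ _ := Model.isCell57.connected Model.isRank

theorem facetsAre_polytope : polytope.{u}.FacetsAre HemiDodecaPoset := fun F hF =>
  have ⟨_, L⟩ := Model.isCell57.down F (Model.isRank.isCoatom_iff.2 hF)
  L.nonempty_orderIso_dual

theorem vertexFiguresAre_polytope : polytope.{u}.VertexFiguresAre HemiIcosaPoset := fun x hx =>
  have ⟨_, L⟩ := Model.isCell57.up x (Model.isRank.isAtom_iff.2 hx)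
  L.nonempty_orderIso

theorem isRank_polytope (P : APolytope.{u} 4) : IsRank P.rank :=
  ⟨P.rank_strictMono, P.rank_bot, P.rank_top, P.flag_ranks⟩

theorem isCell57_of_polytope {P : APolytope.{u} 4} (hF : P.FacetsAre HemiDodecaPoset)
    (hV : P.VertexFiguresAre HemiIcosaPoset) : IsCell57 P.α :=
  (isRank_polytope P).isCell57 hV hF fun c d hc hd =>
    Relation.ReflTransGen.mono (fun _ _ ⟨h, _, F, _, hF, _⟩ => ⟨h, F, hF⟩) _ _
      (P.connected c d hc hd)

end Cell57

/-- There exists a rank-4 abstract polytope all of whose facets are isomorphic to the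
hemidodecahedron `{5,3}₅` and all of whose vertex figures are isomorphic to the
hemi-icosahedron `{3,5}₅` (the 57-cell); any two such polytopes are isomorphic; and any
such polytope has exactly 57 faces of rank 3 and its automorphism group has order 3420. -/
theorem statement_5 :
    (∃ P : APolytope.{u} 4,
      P.FacetsAre HemiDodecaPoset ∧ P.VertexFiguresAre HemiIcosaPoset) ∧
    (∀ (P : APolytope.{u} 4) (Q : APolytope.{v} 4),
      P.FacetsAre HemiDodecaPoset → P.VertexFiguresAre HemiIcosaPoset →
      Q.FacetsAre HemiDodecaPoset → Q.VertexFiguresAre HemiIcosaPoset → P.Iso Q) ∧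
    (∀ P : APolytope.{u} 4,
      P.FacetsAre HemiDodecaPoset → P.VertexFiguresAre HemiIcosaPoset →
      Nat.card {F : P.α // P.rank F = 3} = 57 ∧ Nat.card (P.α ≃o P.α) = 3420) := by
  refine ⟨⟨Cell57.polytope, Cell57.facetsAre_polytope, Cell57.vertexFiguresAre_polytope⟩,
    fun P Q hPF hPV hQF hQV => ?_, fun P hF hV => ?_⟩
  · exact (Cell57.isCell57_of_polytope hPF hPV).nonempty_orderIso
      (Cell57.isCell57_of_polytope hQF hQV) Cell57.grpFacts
  · have C := Cell57.isCell57_of_polytope hF hV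
    refine ⟨?_, C.card_orderIso Cell57.grpFacts⟩
    rw [← C.card_coatom Cell57.grpFacts]
    exact Nat.card_congr (Equiv.subtypeEquivRight fun _ =>
      (Cell57.isRank_polytope P).isCoatom_iff.symm)
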